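/- arXiv:1204.6419 — 6 statements merged into one kernel-verified Lean document; each statement's English description precedes it below -/
import Mathlib

section
/- Let σ be a Y-periodic stress field on ℝ² that is divergence-free in the sense of distributions, and suppose σ is continuous on an open neighborhood of the vertical line {β} × ℝ for some β ∈ ℝ. Then the cell average of σ₁₁ equals its line average over the vertical segment: (1/(l₁l₂)) ∫_Y σ₁₁ dx = (1/l₂) ∫_0^{l₂} σ₁₁(β, y) dy. -/
open MeasureTheory Set

/-- First partial derivative of a scalar field on `ℝ × ℝ`. -/
noncomputable def pd1 (f : ℝ × ℝ → ℝ) (p : ℝ × ℝ) : ℝ := fderiv ℝ f p (1, 0)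

/-- Second partial derivative of a scalar field on `ℝ × ℝ`. -/
noncomputable def pd2 (f : ℝ × ℝ → ℝ) (p : ℝ × ℝ) : ℝ := fderiv ℝ f p (0, 1)

lemma fold_aux {G : Type*} [AddCommGroup G] [MeasurableSpace G] [MeasurableAdd G]
    (μ : Measure G) [μ.IsAddRightInvariant]
    (S : Set G) (hS : MeasurableSet S) (v : G) (hd : ∀ p ∈ S, p - v ∉ S)
    (F : G → ℝ) (hF : Integrable F μ) (h0 : ∀ p, p ∉ S → p - v ∉ S → F p = 0) :
    ∫ p, F p ∂μ = ∫ p in S, (F p + F (p + v)) ∂μ := by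
  have hFv : Integrable (fun p => F (p + v)) μ := hF.comp_add_right v
  rw [integral_add hF.integrableOn hFv.integrableOn, ← integral_indicator hS,
    ← integral_indicator hS]
  have h1 : ∫ p, S.indicator (fun p => F (p + v)) p ∂μ
      = ∫ p, S.indicator (fun p => F (p + v)) (p - v) ∂μ := by
    rw [← integral_add_right_eq_self _ (-v)]
    simp only [sub_eq_add_neg]
  have hi : Integrable (fun p => S.indicator (fun p => F (p + v)) (p - v)) μ := by
    have := (hFv.indicator hS).comp_add_right (-v)
    simpa only [sub_eq_add_neg] using this
  rw [h1, ← integral_add (hF.indicator hS) hi]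
  congr 1
  funext p
  by_cases hp : p ∈ S
  · simp [hp, hd p hp]
  · by_cases hq : p - v ∈ S
    · simp [hp, hq]
    · simp [hp, hq, h0 p hp hq]

lemma chi_exists (l : ℝ) (hl : 0 < l) : ∃ χ : ℝ → ℝ, ContDiff ℝ (⊤ : ℕ∞) χ ∧
    (∀ y, y ∉ Ioc 0 l → y - l ∉ Ioc 0 l → χ y = 0 ∧ deriv χ y = 0) ∧
    (∀ y ∈ Ioc 0 l, χ y + χ (y + l) = 1 ∧ deriv χ y + deriv χ (y + l) = 0) := by
  let H : ℝ → ℝ := fun y => Real.smoothTransition (2 * y / l - 1/2)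
  have hH : ContDiff ℝ (⊤ : ℕ∞) H := by
    apply Real.smoothTransition.contDiff.comp
    fun_prop
  have H0 : ∀ y, y ≤ l / 4 → H y = 0 := by
    intro y hy
    apply Real.smoothTransition.zero_of_nonpos
    have : 2 * y / l ≤ 1/2 := by rw [div_le_iff₀ hl]; linarith
    linarith
  have H1 : ∀ y, 3 * l / 4 ≤ y → H y = 1 := by
    intro y hy
    apply Real.smoothTransition.one_of_one_le
    have : 3/2 ≤ 2 * y / l := by rw [le_div_iff₀ hl]; linarith
    linarith
  let χ : ℝ → ℝ := fun y => H y - H (y - l)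
  have hχ : ContDiff ℝ (⊤ : ℕ∞) χ := hH.sub (hH.comp (by fun_prop))
  have hχd : Differentiable ℝ χ := hχ.differentiable (by simp)
  have hlo : ∀ y, y < l / 4 → χ y = 0 := by
    intro y hy
    simp only [χ]; rw [H0 y (by linarith), H0 _ (by linarith)]; simp
  have hhi : ∀ y, 7 * l / 4 < y → χ y = 0 := by
    intro y hy
    simp only [χ]; rw [H1 y (by linarith), H1 _ (by linarith)]; simp
  have hsum : ∀ y, -(l/4) < y → y < 5 * l / 4 → χ y + χ (y + l) = 1 := by
    intro y h1 h2
    simp only [χ]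
    rw [add_sub_cancel_right, H1 (y + l) (by linarith), H0 (y - l) (by linarith)]
    ring
  refine ⟨χ, hχ, ?_, ?_⟩
  · intro y h1 h2
    have : y ≤ 0 ∨ 2 * l < y := by
      by_contra! h
      by_cases hy : y ≤ l
      · exact h1 ⟨h.1, hy⟩
      · exact h2 ⟨by linarith, by linarith⟩
    rcases this with h | h
    · refine ⟨hlo y (by linarith), ?_⟩
      have : χ =ᶠ[nhds y] fun _ => 0 := by
        filter_upwards [Iio_mem_nhds (show y < l / 4 by linarith)] with z hz using hlo z hz
      rw [this.deriv_eq]; simp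
    · refine ⟨hhi y (by linarith), ?_⟩
      have : χ =ᶠ[nhds y] fun _ => 0 := by
        filter_upwards [Ioi_mem_nhds (show 7 * l / 4 < y by linarith)] with z hz using hhi z hz
      rw [this.deriv_eq]; simp
  · intro y hy
    refine ⟨hsum y (by linarith [hy.1]) (by linarith [hy.2]), ?_⟩
    have : (fun z => χ z + χ (z + l)) =ᶠ[nhds y] fun _ => 1 := by
      filter_upwards [Ioi_mem_nhds (show -(l/4) < y by linarith [hy.1]),
        Iio_mem_nhds (show y < 5 * l / 4 by linarith [hy.2])] with z hz hz' using hsum z hz hz'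
    have h2 := this.deriv_eq
    rw [deriv_fun_add (hχd y) (show DifferentiableAt ℝ (fun z => χ (z + l)) y from (hχd.comp (by fun_prop : Differentiable ℝ (fun z : ℝ => z + l))) y)] at h2
    simpa [deriv_comp_add_const] using h2

lemma int_aux (f : ℝ × ℝ → ℝ) (hf : LocallyIntegrable f volume) (a b : ℝ → ℝ)
    (ha : Continuous a) (hb : Continuous b) (ha' : HasCompactSupport a)
    (hb' : HasCompactSupport b) :
    Integrable (fun p : ℝ × ℝ => f p * (a p.1 * b p.2)) := by
  have hc : Continuous (fun p : ℝ × ℝ => a p.1 * b p.2) := by fun_prop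
  have hk : HasCompactSupport (fun p : ℝ × ℝ => a p.1 * b p.2) := by
    apply HasCompactSupport.intro (ha'.isCompact.prod hb'.isCompact)
    intro p hp
    by_cases h : p.1 ∈ tsupport a
    · have : p.2 ∉ tsupport b := fun h' => hp ⟨h, h'⟩
      simp [image_eq_zero_of_notMem_tsupport this]
    · simp [image_eq_zero_of_notMem_tsupport h]
  have := hf.integrable_smul_right_of_hasCompactSupport hc hk
  simpa [smul_eq_mul] using this

lemma fold_y (l : ℝ) (hl : 0 < l) (f : ℝ × ℝ → ℝ) (hf : LocallyIntegrable f volume)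
    (hper : ∀ᵐ p : ℝ × ℝ ∂volume, f (p.1, p.2 + l) = f p) (a b : ℝ → ℝ)
    (ha : Continuous a) (hb : Continuous b) (ha' : HasCompactSupport a)
    (hb' : HasCompactSupport b)
    (hb0 : ∀ y, y ∉ Ioc 0 l → y - l ∉ Ioc 0 l → b y = 0) (c : ℝ)
    (hb1 : ∀ y ∈ Ioc 0 l, b y + b (y + l) = c) :
    ∫ p : ℝ × ℝ, f p * (a p.1 * b p.2) = ∫ p in univ ×ˢ Ioc 0 l, f p * a p.1 * c := by
  have hS : MeasurableSet ((univ : Set ℝ) ×ˢ Ioc 0 l) := MeasurableSet.univ.prod measurableSet_Ioc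
  rw [fold_aux volume (univ ×ˢ Ioc 0 l) hS ((0, l) : ℝ × ℝ) ?_ _
    (int_aux f hf a b ha hb ha' hb') ?_]
  · apply setIntegral_congr_ae hS
    filter_upwards [hper] with p hp hpS
    have e : p + (0, l) = (p.1, p.2 + l) := by ext <;> simp
    rw [e, hp, ← hb1 p.2 hpS.2]
    ring
  · intro p hp hp'
    have h1 := hp.2.2
    have h2 := hp'.2.1
    simp at h1 h2
    linarith
  · intro p h1 h2
    simp only [mem_prod, mem_univ, true_and] at h1 h2
    simp [hb0 p.2 h1 h2]

lemma fold_x (l m : ℝ) (hl : 0 < l) (hm : 0 < m) (f : ℝ × ℝ → ℝ) (hf : LocallyIntegrable f volume)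
    (hper : ∀ᵐ p : ℝ × ℝ ∂volume, f (p.1 + l, p.2) = f p) (a : ℝ → ℝ)
    (ha : Continuous a) (ha' : HasCompactSupport a)
    (ha0 : ∀ y, y ∉ Ioc 0 l → y - l ∉ Ioc 0 l → a y = 0)
    (ha1 : ∀ y ∈ Ioc 0 l, a y + a (y + l) = 1)
    (hint : IntegrableOn (fun p => f p * a p.1) (univ ×ˢ Ioc 0 m)) :
    ∫ p in univ ×ˢ Ioc 0 m, f p * a p.1 = ∫ p in Ioc 0 l ×ˢ Ioc 0 m, f p := by
  have hT : MeasurableSet ((univ : Set ℝ) ×ˢ Ioc 0 m) := MeasurableSet.univ.prod measurableSet_Ioc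
  have hS : MeasurableSet (Ioc 0 l ×ˢ (univ : Set ℝ)) := measurableSet_Ioc.prod MeasurableSet.univ
  have hST : MeasurableSet (Ioc 0 l ×ˢ Ioc 0 m) := measurableSet_Ioc.prod measurableSet_Ioc
  rw [← integral_indicator hT, fold_aux volume (Ioc 0 l ×ˢ univ) hS ((l, 0) : ℝ × ℝ) ?_ _
    (hint.integrable_indicator hT) ?_]
  · rw [← integral_indicator hS, ← integral_indicator hST]
    apply integral_congr_ae
    filter_upwards [hper] with p hp
    have e : p + (l, 0) = (p.1 + l, p.2) := by ext <;> simp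
    by_cases h1 : p.1 ∈ Ioc 0 l
    · rw [indicator_of_mem (show p ∈ Ioc 0 l ×ˢ (univ : Set ℝ) from ⟨h1, mem_univ _⟩)]
      by_cases h2 : p.2 ∈ Ioc 0 m
      · rw [indicator_of_mem (show p ∈ Ioc 0 l ×ˢ Ioc 0 m from ⟨h1, h2⟩), e,
          indicator_of_mem (show p ∈ (univ : Set ℝ) ×ˢ Ioc 0 m from ⟨mem_univ _, h2⟩),
          indicator_of_mem (show (p.1 + l, p.2) ∈ (univ : Set ℝ) ×ˢ Ioc 0 m from ⟨mem_univ _, h2⟩), hp,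
          ← mul_add, ha1 _ h1, mul_one]
      · rw [indicator_of_notMem (fun h : p ∈ Ioc 0 l ×ˢ Ioc 0 m => h2 h.2), e,
          indicator_of_notMem (fun h : p ∈ (univ : Set ℝ) ×ˢ Ioc 0 m => h2 h.2),
          indicator_of_notMem (fun h : (p.1 + l, p.2) ∈ (univ : Set ℝ) ×ˢ Ioc 0 m => h2 h.2), add_zero]
    · rw [indicator_of_notMem (fun h : p ∈ Ioc 0 l ×ˢ (univ : Set ℝ) => h1 h.1),
        indicator_of_notMem (fun h : p ∈ Ioc 0 l ×ˢ Ioc 0 m => h1 h.1)]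
  · intro p hp hp'
    have h1 := hp.1.2
    have h2 := hp'.1.1
    simp at h1 h2
    linarith
  · intro p h1 h2
    simp only [mem_prod, mem_univ, and_true] at h1 h2
    simp [indicator, ha0 p.1 h1 h2]

lemma prim_aux (h : ℝ → ℝ) (hs : ContDiff ℝ (⊤ : ℕ∞) h) (hc : HasCompactSupport h)
    (h0 : ∫ x, h x = 0) : ∃ ψ : ℝ → ℝ, ContDiff ℝ (⊤ : ℕ∞) ψ ∧ HasCompactSupport ψ ∧
      ∀ x, HasDerivAt ψ (h x) x := by
  obtain ⟨R, hR⟩ := hc.isCompact.isBounded.subset_ball (0 : ℝ)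
  have hz : ∀ x, R ≤ |x| → h x = 0 := by
    intro x hx
    apply image_eq_zero_of_notMem_tsupport
    intro hx'
    have := hR hx'
    simp at this
    linarith
  let ψ : ℝ → ℝ := fun x => ∫ t in (-R)..x, h t
  have hd : ∀ x, HasDerivAt ψ (h x) x := fun x =>
    hs.continuous.integral_hasStrictDerivAt (-R) x |>.hasDerivAt
  refine ⟨ψ, ?_, ?_, hd⟩
  · rw [contDiff_infty_iff_deriv]
    refine ⟨fun x => (hd x).differentiableAt, ?_⟩
    have : deriv ψ = h := funext fun x => (hd x).deriv
    rwa [this]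
  · apply HasCompactSupport.intro (isCompact_Icc : IsCompact (Icc (-R) R))
    intro x hx
    by_cases h1 : x < -R
    · simp only [ψ]
      rw [intervalIntegral.integral_congr (g := fun _ => 0)]
      · simp
      · intro t ht
        rw [uIcc_of_ge h1.le] at ht
        apply hz
        have := neg_abs_le t
        linarith [ht.2]
    · have h2 : R < x := by
        by_contra! h2
        exact hx ⟨not_lt.1 h1, h2⟩
      simp only [ψ]
      rw [intervalIntegral.integral_eq_integral_of_support_subset, h0]
      intro t ht
      have : |t| < R := by
        by_contra! h'
        exact ht (hz t h')
      rw [abs_lt] at this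
      exact ⟨this.1, by linarith⟩

lemma strip_int (l : ℝ) (hl : 0 < l) (f : ℝ × ℝ → ℝ) (hf : LocallyIntegrable f volume)
    (a : ℝ → ℝ) (ha : Continuous a) (ha' : HasCompactSupport a) :
    IntegrableOn (fun p => f p * a p.1) (univ ×ˢ Ioc 0 l) := by
  let c : ContDiffBump (0 : ℝ) := ⟨l, l + 1, hl, by linarith⟩
  have h := (int_aux f hf a c ha c.continuous ha' c.hasCompactSupport).integrableOn
    (s := univ ×ˢ Ioc 0 l)
  refine h.congr_fun ?_ (MeasurableSet.univ.prod measurableSet_Ioc)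
  intro p hp
  have : c p.2 = 1 := by
    apply c.one_of_mem_closedBall
    have h2 := hp.2
    simp only [Metric.mem_closedBall, dist_zero_right, Real.norm_eq_abs, c]
    rw [abs_of_pos h2.1]
    exact h2.2
  simp [this]

lemma compact_of_fold (l : ℝ) (b : ℝ → ℝ)
    (hb0 : ∀ y, y ∉ Ioc 0 l → y - l ∉ Ioc 0 l → b y = 0) : HasCompactSupport b := by
  apply HasCompactSupport.intro (isCompact_Icc : IsCompact (Icc (0 : ℝ) (2 * l)))
  intro y hy
  apply hb0
  · intro h
    exact hy ⟨h.1.le, by linarith [h.2, h.1]⟩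
  · intro h
    exact hy ⟨by linarith [h.1, h.2], by linarith [h.2, h.1]⟩

lemma pd_aux (a b : ℝ → ℝ) (p : ℝ × ℝ) (a' b' : ℝ) (ha : HasDerivAt a a' p.1)
    (hb : HasDerivAt b b' p.2) :
    pd1 (fun q => a q.1 * b q.2) p = a' * b p.2 ∧ pd2 (fun q => a q.1 * b q.2) p = a p.1 * b' := by
  have h1 : HasFDerivAt (fun q : ℝ × ℝ => a q.1) _ p :=
    ha.hasFDerivAt.comp p (hasFDerivAt_fst (𝕜 := ℝ) (p := p))
  have h2 : HasFDerivAt (fun q : ℝ × ℝ => b q.2) _ p :=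
    hb.hasFDerivAt.comp p (hasFDerivAt_snd (𝕜 := ℝ) (p := p))
  have h := (h1.mul h2).fderiv
  have h' : fderiv ℝ (fun q : ℝ × ℝ => a q.1 * b q.2) p = _ := h
  constructor
  · unfold pd1
    rw [h']
    simp [mul_comm]
  · unfold pd2
    rw [h']
    simp

/-- For a `Y`-periodic, distributionally divergence-free stress field that is continuous on a
neighborhood of the vertical line `{β} × ℝ`, the cell average of `σ₁₁` equals its line average
over the vertical segment. -/
theorem cell_average_eq_line_average_sigma11
    (l₁ l₂ : ℝ) (hl₁ : 0 < l₁) (hl₂ : 0 < l₂)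
    (σ11 σ12 σ22 : ℝ × ℝ → ℝ)
    (hloc11 : LocallyIntegrable σ11 volume)
    (hloc12 : LocallyIntegrable σ12 volume)
    (hloc22 : LocallyIntegrable σ22 volume)
    (hper : ∀ᵐ p : ℝ × ℝ ∂volume,
      σ11 (p.1 + l₁, p.2) = σ11 p ∧ σ11 (p.1, p.2 + l₂) = σ11 p ∧
      σ12 (p.1 + l₁, p.2) = σ12 p ∧ σ12 (p.1, p.2 + l₂) = σ12 p ∧
      σ22 (p.1 + l₁, p.2) = σ22 p ∧ σ22 (p.1, p.2 + l₂) = σ22 p)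
    (hdiv : ∀ φ₁ φ₂ : ℝ × ℝ → ℝ, ContDiff ℝ (⊤ : ℕ∞) φ₁ → ContDiff ℝ (⊤ : ℕ∞) φ₂ →
      HasCompactSupport φ₁ → HasCompactSupport φ₂ →
      ∫ p : ℝ × ℝ, (σ11 p * pd1 φ₁ p + σ12 p * pd2 φ₁ p
        + σ12 p * pd1 φ₂ p + σ22 p * pd2 φ₂ p) = 0)
    (β : ℝ)
    (hcont : ∃ U : Set (ℝ × ℝ), IsOpen U ∧ (∀ y : ℝ, (β, y) ∈ U) ∧
      ContinuousOn σ11 U ∧ ContinuousOn σ12 U ∧ ContinuousOn σ22 U) :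
    (1 / (l₁ * l₂)) * ∫ p in Ioo (0:ℝ) l₁ ×ˢ Ioo (0:ℝ) l₂, σ11 p
      = (1 / l₂) * ∫ y in (0:ℝ)..l₂, σ11 (β, y) := by
  obtain ⟨U, hUo, hUβ, hc11, -, -⟩ := hcont
  have hcell : ∫ p in Ioo (0:ℝ) l₁ ×ˢ Ioo (0:ℝ) l₂, σ11 p = ∫ p in Ioc (0:ℝ) l₁ ×ˢ Ioc (0:ℝ) l₂, σ11 p := by
    apply setIntegral_congr_set
    exact Measure.set_prod_ae_eq Ioo_ae_eq_Ioc Ioo_ae_eq_Ioc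
  rw [hcell, intervalIntegral.integral_of_le hl₂.le]
  obtain ⟨χ₁, hχ₁, hχ₁0, hχ₁1⟩ := chi_exists l₁ hl₁
  obtain ⟨χ₂, hχ₂, hχ₂0, hχ₂1⟩ := chi_exists l₂ hl₂
  have hk₁ := compact_of_fold l₁ χ₁ fun y h h' => (hχ₁0 y h h').1
  have hk₂ := compact_of_fold l₂ χ₂ fun y h h' => (hχ₂0 y h h').1
  have hk₂' := compact_of_fold l₂ (deriv χ₂) fun y h h' => (hχ₂0 y h h').2
  have hχ₁int : ∫ x, χ₁ x = l₁ := by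
    rw [fold_aux volume (Ioc 0 l₁) measurableSet_Ioc l₁ ?_ χ₁
      (hχ₁.continuous.integrable_of_hasCompactSupport hk₁) (fun y h h' => (hχ₁0 y h h').1),
      setIntegral_congr_fun measurableSet_Ioc (g := fun _ => (1 : ℝ)) (fun y hy => (hχ₁1 y hy).1)]
    · simp [hl₁.le]
    · intro p h h'
      linarith [h.2, h'.1]
  set I := ∫ p in Ioc (0:ℝ) l₁ ×ˢ Ioc (0:ℝ) l₂, σ11 p with hI
  set J := ∫ y in Ioc (0:ℝ) l₂, σ11 (β, y) with hJ
  have hβc : ∀ y, ContinuousAt σ11 (β, y) := fun y =>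
    hc11.continuousAt (hUo.mem_nhds (hUβ y))
  have hline : Continuous fun y => σ11 (β, y) := by
    rw [continuous_iff_continuousAt]
    intro y
    exact ContinuousAt.comp (f := fun y => (β, y)) (hβc y) (by fun_prop)
  have hT : MeasurableSet ((univ : Set ℝ) ×ˢ Ioc 0 l₂) := MeasurableSet.univ.prod measurableSet_Ioc
  -- key estimate
  have key : ∀ ε > 0, |I - l₁ * J| ≤ ε * (l₁ * l₂) := by
    intro ε hε
    have hev : ∀ᶠ x in nhds β, ∀ y ∈ Icc 0 l₂, |σ11 (x, y) - σ11 (β, y)| < ε := by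
      apply isCompact_Icc.eventually_forall_of_forall_eventually
        (P := fun x y => |σ11 (x, y) - σ11 (β, y)| < ε)
      intro y _
      have hca : ContinuousAt (fun z : ℝ × ℝ => |σ11 (z.1, z.2) - σ11 (β, z.2)|) (β, y) := by
        apply ContinuousAt.abs
        apply ContinuousAt.sub
        · exact hβc y
        · exact (hline.comp continuous_snd).continuousAt
      exact hca.eventually_lt continuousAt_const (by simpa using hε)
    obtain ⟨δ, hδ, hball⟩ := Metric.eventually_nhds_iff_ball.1 hev
    let B : ContDiffBump β := ⟨δ / 2, δ, by linarith, by linarith⟩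
    let η : ℝ → ℝ := fun x => l₁ * B.normed volume x
    have hηs : ContDiff ℝ (⊤ : ℕ∞) η := contDiff_const.mul B.contDiff_normed
    have hηk : HasCompactSupport η := B.hasCompactSupport_normed.mul_left
    have hηi : ∫ x, η x = l₁ := by
      simp only [η]
      rw [integral_const_mul, B.integral_normed, mul_one]
    have hη0 : ∀ x, 0 ≤ η x := fun x => mul_nonneg hl₁.le (B.nonneg_normed x)
    have hηsup : ∀ x, x ∉ Metric.ball β δ → η x = 0 := by
      intro x hx
      have : x ∉ Function.support (B.normed volume) := by
        rw [B.support_normed_eq]; exact hx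
      simp only [Function.mem_support, not_not] at this
      simp [η, this]
    have hηint : Integrable η := hηs.continuous.integrable_of_hasCompactSupport hηk
    obtain ⟨ψ, hψ, hψk, hψd⟩ := prim_aux (fun x => χ₁ x - η x) (hχ₁.sub hηs) (hk₁.sub hηk) (by
      rw [integral_sub (hχ₁.continuous.integrable_of_hasCompactSupport hk₁) hηint, hχ₁int, hηi,
        sub_self])
    have hχ₂d : ∀ y, HasDerivAt χ₂ (deriv χ₂ y) y := fun y =>
      (hχ₂.differentiable (by simp) y).hasDerivAt
    have hχ₂dc : Continuous (deriv χ₂) := hχ₂.continuous_deriv (by simp)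
    have hφk : HasCompactSupport (fun p : ℝ × ℝ => ψ p.1 * χ₂ p.2) := by
      apply HasCompactSupport.intro (hψk.isCompact.prod hk₂.isCompact)
      intro p hp
      by_cases h : p.1 ∈ tsupport ψ
      · have : p.2 ∉ tsupport χ₂ := fun h' => hp ⟨h, h'⟩
        simp [image_eq_zero_of_notMem_tsupport this]
      · simp [image_eq_zero_of_notMem_tsupport h]
    have hmain := hdiv (fun p => ψ p.1 * χ₂ p.2) (fun _ => 0)
      ((hψ.comp contDiff_fst).mul (hχ₂.comp contDiff_snd)) contDiff_const hφk
      (HasCompactSupport.zero)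
    have i1 := int_aux σ11 hloc11 χ₁ χ₂ hχ₁.continuous hχ₂.continuous hk₁ hk₂
    have i2 := int_aux σ11 hloc11 η χ₂ hηs.continuous hχ₂.continuous hηk hk₂
    have i3 := int_aux σ12 hloc12 ψ (deriv χ₂) hψ.continuous hχ₂dc hψk hk₂'
    have e : (fun p : ℝ × ℝ => σ11 p * pd1 (fun p => ψ p.1 * χ₂ p.2) p
        + σ12 p * pd2 (fun p => ψ p.1 * χ₂ p.2) p
        + σ12 p * pd1 (fun _ => 0) p + σ22 p * pd2 (fun _ => 0) p)
        = fun p => (σ11 p * (χ₁ p.1 * χ₂ p.2) - σ11 p * (η p.1 * χ₂ p.2))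
          + σ12 p * (ψ p.1 * deriv χ₂ p.2) := by
      funext p
      obtain ⟨e1, e2⟩ := pd_aux ψ χ₂ p _ _ (hψd p.1) (hχ₂d p.2)
      rw [e1, e2]
      simp [pd1, pd2]
      ring
    have i12 : Integrable (fun p : ℝ × ℝ =>
        σ11 p * (χ₁ p.1 * χ₂ p.2) - σ11 p * (η p.1 * χ₂ p.2)) := i1.sub i2
    rw [e, integral_add i12 i3, integral_sub i1 i2] at hmain
    rw [fold_y l₂ hl₂ σ11 hloc11 (hper.mono fun p h => h.2.1) χ₁ χ₂ hχ₁.continuous hχ₂.continuous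
        hk₁ hk₂ (fun y h h' => (hχ₂0 y h h').1) 1 (fun y hy => (hχ₂1 y hy).1),
      fold_y l₂ hl₂ σ11 hloc11 (hper.mono fun p h => h.2.1) η χ₂ hηs.continuous hχ₂.continuous
        hηk hk₂ (fun y h h' => (hχ₂0 y h h').1) 1 (fun y hy => (hχ₂1 y hy).1),
      fold_y l₂ hl₂ σ12 hloc12 (hper.mono fun p h => h.2.2.2.1) ψ (deriv χ₂) hψ.continuous hχ₂dc
        hψk hk₂' (fun y h h' => (hχ₂0 y h h').2) 0 (fun y hy => (hχ₂1 y hy).2)] at hmain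
    simp only [mul_one, mul_zero, integral_zero, add_zero] at hmain
    rw [fold_x l₁ l₂ hl₁ hl₂ σ11 hloc11 (hper.mono fun p h => h.1) χ₁ hχ₁.continuous hk₁
      (fun y h h' => (hχ₁0 y h h').1) (fun y hy => (hχ₁1 y hy).1)
      (strip_int l₂ hl₂ σ11 hloc11 χ₁ hχ₁.continuous hk₁), ← hI] at hmain
    have hprod : ∫ p in (univ : Set ℝ) ×ˢ Ioc 0 l₂, η p.1 * σ11 (β, p.2) = l₁ * J := by
      have := setIntegral_prod_mul (μ := (volume : Measure ℝ)) (ν := (volume : Measure ℝ))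
        η (fun y => σ11 (β, y)) univ (Ioc 0 l₂)
      rw [Measure.volume_eq_prod, this, setIntegral_univ, hηi]
    have hprod2 : ∫ p in (univ : Set ℝ) ×ˢ Ioc 0 l₂, η p.1 * ε = l₁ * (l₂ * ε) := by
      have := setIntegral_prod_mul (μ := (volume : Measure ℝ)) (ν := (volume : Measure ℝ))
        η (fun y => ε) univ (Ioc 0 l₂)
      rw [Measure.volume_eq_prod, this, setIntegral_univ, hηi]
      simp [hl₂.le]
    have j1 : IntegrableOn (fun p : ℝ × ℝ => σ11 p * η p.1) (univ ×ˢ Ioc 0 l₂) :=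
      strip_int l₂ hl₂ σ11 hloc11 η hηs.continuous hηk
    have j2 : IntegrableOn (fun p : ℝ × ℝ => η p.1 * σ11 (β, p.2)) (univ ×ˢ Ioc 0 l₂) := by
      have := strip_int l₂ hl₂ (fun p => σ11 (β, p.2))
        (hline.comp continuous_snd).locallyIntegrable η hηs.continuous hηk
      simpa only [mul_comm] using this
    have j3 : IntegrableOn (fun p : ℝ × ℝ => η p.1 * ε) (univ ×ˢ Ioc 0 l₂) := by
      have := strip_int l₂ hl₂ (fun p => ε)
        continuous_const.locallyIntegrable η hηs.continuous hηk
      simpa only [mul_comm] using this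
    have hIe : I - l₁ * J = ∫ p in (univ : Set ℝ) ×ˢ Ioc 0 l₂,
        (σ11 p * η p.1 - η p.1 * σ11 (β, p.2)) := by
      rw [integral_sub j1 j2, hprod]
      linarith
    rw [hIe, ← Real.norm_eq_abs]
    calc _ ≤ ∫ p in (univ : Set ℝ) ×ˢ Ioc 0 l₂, η p.1 * ε := by
          apply norm_integral_le_of_norm_le j3
          rw [ae_restrict_iff' hT]
          refine Filter.Eventually.of_forall fun p hp => ?_
          by_cases hb : p.1 ∈ Metric.ball β δ
          · have := hball p.1 hb p.2 ⟨hp.2.1.le, hp.2.2⟩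
            have e2 : σ11 p * η p.1 - η p.1 * σ11 (β, p.2)
              = η p.1 * (σ11 (p.1, p.2) - σ11 (β, p.2)) := by
              rw [Prod.mk.eta]; ring
            rw [e2, norm_mul, Real.norm_eq_abs, Real.norm_eq_abs, abs_of_nonneg (hη0 _)]
            exact mul_le_mul_of_nonneg_left this.le (hη0 _)
          · simp [hηsup _ hb]
      _ = ε * (l₁ * l₂) := by rw [hprod2]; ring
  have hzero : I = l₁ * J := by
    by_contra hne
    have hpos : 0 < |I - l₁ * J| := abs_pos.2 (sub_ne_zero.2 hne)
    have hll : 0 < l₁ * l₂ := mul_pos hl₁ hl₂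
    have := key (|I - l₁ * J| / (2 * (l₁ * l₂))) (by positivity)
    have e : |I - l₁ * J| / (2 * (l₁ * l₂)) * (l₁ * l₂) = |I - l₁ * J| / 2 := by
      field_simp
    rw [e] at this
    linarith
  rw [hzero]
  field_simp
end

section
/- Let σ be a Y-periodic stress field on ℝ² that is divergence-free in the sense of distributions, and suppose σ is continuous on an open neighborhood of the horizontal line ℝ × {α} for some α ∈ ℝ. Then the cell average of σ₂₂ equals its line average over the horizontal segment: (1/(l₁l₂)) ∫_Y σ₂₂ dx = (1/l₁) ∫_0^{l₁} σ₂₂(x, α) dx. -/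
open MeasureTheory Set

open scoped ContDiff Topology

lemma aux_hcs {a b : ℝ → ℝ} (ha : HasCompactSupport a) (hb : HasCompactSupport b) :
    HasCompactSupport (fun p : ℝ × ℝ => a p.1 * b p.2) := by
  refine HasCompactSupport.intro (IsCompact.prod ha hb) ?_
  rintro ⟨x, y⟩ h
  by_cases hx : x ∈ tsupport a
  · have hy : y ∉ tsupport b := fun hy => h ⟨hx, hy⟩
    simp [image_eq_zero_of_notMem_tsupport hy]
  · simp [image_eq_zero_of_notMem_tsupport hx]

lemma aux_int {s : ℝ × ℝ → ℝ} (hs : LocallyIntegrable s volume) {a b : ℝ → ℝ}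
    (ca : Continuous a) (cb : Continuous b)
    (ha : HasCompactSupport a) (hb : HasCompactSupport b) :
    Integrable (fun p : ℝ × ℝ => s p * (a p.1 * b p.2)) volume := by
  have := hs.integrable_smul_right_of_hasCompactSupport
    (g := fun p : ℝ × ℝ => a p.1 * b p.2) (by fun_prop) (aux_hcs ha hb)
  simpa using this

lemma aux_shift {s : ℝ × ℝ → ℝ} (hs : LocallyIntegrable s volume) (l : ℝ)
    (hper : ∀ᵐ p : ℝ × ℝ ∂volume, s (p.1 + l, p.2) = s p) {a b : ℝ → ℝ}
    (ca : Continuous a) (cb : Continuous b)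
    (ha : HasCompactSupport a) (hb : HasCompactSupport b) :
    ∫ p : ℝ × ℝ, s p * ((a p.1 - a (p.1 - l)) * b p.2) = 0 := by
  have ha' : HasCompactSupport (fun x => a (x - l)) := by
    have := ha.comp_homeomorph (Homeomorph.addRight (-l))
    simpa [Function.comp_def, sub_eq_add_neg] using this
  have h1 := aux_int hs ca cb ha hb
  have h2 := aux_int hs (a := fun x => a (x - l)) (by fun_prop) cb ha' hb
  have e : ∀ p : ℝ × ℝ, s p * ((a p.1 - a (p.1 - l)) * b p.2)
      = s p * (a p.1 * b p.2) - s p * (a (p.1 - l) * b p.2) := fun p => by ring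
  simp_rw [e]
  rw [integral_sub h1 h2, sub_eq_zero,
    ← integral_add_right_eq_self (fun p : ℝ × ℝ => s p * (a (p.1 - l) * b p.2)) (l, 0)]
  apply integral_congr_ae
  filter_upwards [hper] with p hp
  have : p + (l, 0) = (p.1 + l, p.2) := by ext <;> simp
  simp [this, hp]

lemma aux_antideriv {η : ℝ → ℝ} (h : ContDiff ℝ ∞ η) (hc : HasCompactSupport η)
    (h0 : ∫ x, η x = 0) :
    ∃ ψ : ℝ → ℝ, ContDiff ℝ ∞ ψ ∧ HasCompactSupport ψ ∧ deriv ψ = η := by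
  obtain ⟨R, hR⟩ := hc.isBounded.subset_closedBall (0:ℝ)
  rw [Real.closedBall_eq_Icc] at hR
  have hz : ∀ x, x ∉ Icc (0 - R) (0 + R) → η x = 0 := fun x hx =>
    image_eq_zero_of_notMem_tsupport (fun h => hx (hR h))
  have hd : ∀ y, HasDerivAt (fun y => ∫ t in (-R - 1)..y, η t) (η y) y := fun y =>
    intervalIntegral.integral_hasDerivAt_right (h.continuous.intervalIntegrable _ _)
      h.continuous.stronglyMeasurable.stronglyMeasurableAtFilter h.continuous.continuousAt
  have hder : deriv (fun y => ∫ t in (-R - 1)..y, η t) = η := funext fun y => (hd y).deriv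
  refine ⟨fun y => ∫ t in (-R - 1)..y, η t, ?_, ?_, hder⟩
  · rw [contDiff_infty_iff_deriv, hder]
    exact ⟨fun y => (hd y).differentiableAt, h⟩
  · refine HasCompactSupport.intro (isCompact_Icc (a := -R - 1) (b := R)) ?_
    intro y hy
    rw [mem_Icc, not_and_or, not_le, not_le] at hy
    rcases hy with hy | hy
    · rw [intervalIntegral.integral_congr (g := fun _ => 0)]
      · simp
      · intro t ht
        rw [uIcc_of_ge hy.le] at ht
        apply hz
        intro h'
        have := ht.2
        have := h'.1
        linarith
    · rw [intervalIntegral.integral_eq_integral_of_support_subset, h0]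
      intro t ht
      have : t ∈ Icc (0 - R) (0 + R) := by
        by_contra h'
        exact ht (hz t h')
      constructor <;> [have := this.1; have := this.2] <;> linarith

lemma aux_const {g : ℝ → ℝ} (hg : LocallyIntegrable g volume)
    (h : ∀ ψ : ℝ → ℝ, ContDiff ℝ ∞ ψ → HasCompactSupport ψ → ∫ y, g y * deriv ψ y = 0) :
    ∃ c : ℝ, ∀ᵐ y, g y = c := by
  let f : ContDiffBump (0:ℝ) := default
  have fs : ContDiff ℝ ∞ (f.normed volume) := f.contDiff_normed
  have fc : HasCompactSupport (f.normed volume) := f.hasCompactSupport_normed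
  have fi : ∫ x, f.normed volume x = 1 := f.integral_normed
  refine ⟨∫ y, g y * f.normed volume y, ?_⟩
  have I : ∀ η : ℝ → ℝ, Continuous η → HasCompactSupport η →
      Integrable (fun y => g y * η y) := fun η h1 h2 => by
    simpa using hg.integrable_smul_right_of_hasCompactSupport h1 h2
  refine ae_eq_of_integral_contDiff_smul_eq hg (locallyIntegrable_const _) ?_
  intro η hη hηc
  have iη : Integrable η := hη.continuous.integrable_of_hasCompactSupport hηc
  have iF : Integrable (f.normed volume) := fs.continuous.integrable_of_hasCompactSupport fc
  obtain ⟨ψ, h1, h2, h3⟩ := aux_antideriv (η := fun y => η y - (∫ x, η x) * f.normed volume y)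
    (by fun_prop) (hηc.sub (fc.mul_left (f := fun _ => ∫ x, η x)))
    (by rw [integral_sub iη (iF.const_mul _), integral_const_mul, fi]; ring)
  have := h ψ h1 h2
  rw [h3] at this
  have e : ∀ y, g y * (η y - (∫ x, η x) * f.normed volume y)
      = g y * η y - (∫ x, η x) * (g y * f.normed volume y) := fun y => by ring
  simp_rw [e] at this
  rw [integral_sub (I _ hη.continuous hηc) ((I _ fs.continuous fc).const_mul _),
    integral_const_mul, sub_eq_zero] at this
  simp only [smul_eq_mul, integral_mul_const]
  rw [← this]
  exact integral_congr_ae (.of_forall fun y => mul_comm _ _)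

/-- cutoff -/
noncomputable def auxF (k : ℝ) (x : ℝ) : ℝ := Real.smoothTransition (k * x)

lemma auxF_smooth (k : ℝ) : ContDiff ℝ ∞ (auxF k) := by
  unfold auxF
  exact Real.smoothTransition.contDiff.comp (by fun_prop)

lemma auxF_deriv_hcs {k : ℝ} (hk : 1 ≤ k) : HasCompactSupport (deriv (auxF k)) := by
  refine HasCompactSupport.intro (isCompact_Icc (a := 0) (b := 1)) ?_
  intro x hx
  rw [mem_Icc, not_and_or, not_le, not_le] at hx
  rcases hx with hx | hx
  · have : auxF k =ᶠ[𝓝 x] fun _ => 0 := by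
      filter_upwards [Iio_mem_nhds hx] with y hy
      have : y < 0 := hy
      exact Real.smoothTransition.zero_of_nonpos (by nlinarith)
    rw [this.deriv_eq]; simp
  · have : auxF k =ᶠ[𝓝 x] fun _ => 1 := by
      filter_upwards [Ioi_mem_nhds hx] with y hy
      have : 1 < y := hy
      exact Real.smoothTransition.one_of_one_le (by nlinarith)
    rw [this.deriv_eq]; simp

/-- smoothed indicator -/
noncomputable def auxX (l k : ℝ) (x : ℝ) : ℝ := auxF k x - auxF k (x - l)

lemma auxX_smooth (l k : ℝ) : ContDiff ℝ ∞ (auxX l k) := by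
  unfold auxX
  exact (auxF_smooth k).sub ((auxF_smooth k).comp (by fun_prop))

lemma auxX_deriv (l k x : ℝ) : deriv (auxX l k) x = deriv (auxF k) x - deriv (auxF k) (x - l) := by
  have hd : Differentiable ℝ (auxF k) := (auxF_smooth k).differentiable (by simp)
  unfold auxX
  rw [deriv_fun_sub (hd x) (by fun_prop), deriv_comp_sub_const]

lemma auxX_zero {l k : ℝ} (hl : 0 < l) (hk : 1 ≤ k) {x : ℝ} (hx : x ≤ 0 ∨ l + 1 ≤ x) :
    auxX l k x = 0 := by
  unfold auxX auxF
  rcases hx with hx | hx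
  · rw [Real.smoothTransition.zero_of_nonpos, Real.smoothTransition.zero_of_nonpos] <;> nlinarith
  · rw [Real.smoothTransition.one_of_one_le, Real.smoothTransition.one_of_one_le] <;> nlinarith

lemma auxX_hcs {l k : ℝ} (hl : 0 < l) (hk : 1 ≤ k) : HasCompactSupport (auxX l k) := by
  refine HasCompactSupport.intro (isCompact_Icc (a := 0) (b := l + 1)) ?_
  intro x hx
  rw [mem_Icc, not_and_or, not_le, not_le] at hx
  exact auxX_zero hl hk (hx.imp le_of_lt le_of_lt)

lemma auxX_bound {l k : ℝ} (hl : 0 < l) (hk : 1 ≤ k) (x : ℝ) :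
    |auxX l k x| ≤ auxX (l + 2) 1 (x + 1) := by
  have hB : 0 ≤ auxX (l + 2) 1 (x + 1) := by
    unfold auxX auxF
    exact sub_nonneg.2 (Real.smoothTransition.monotone (by linarith))
  by_cases hx : x ≤ 0 ∨ l + 1 ≤ x
  · rw [auxX_zero hl hk hx]; simpa using hB
  · push Not at hx
    have : auxX (l + 2) 1 (x + 1) = 1 := by
      unfold auxX auxF
      rw [Real.smoothTransition.one_of_one_le (by linarith),
        Real.smoothTransition.zero_of_nonpos (by linarith)]; simp
    rw [this]
    unfold auxX auxF
    have a1 := Real.smoothTransition.nonneg (k * x)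
    have a2 := Real.smoothTransition.le_one (k * x)
    have a3 := Real.smoothTransition.nonneg (k * (x - l))
    have a4 := Real.smoothTransition.le_one (k * (x - l))
    rw [abs_le]; constructor <;> linarith

lemma auxF_tendsto (x : ℝ) : Filter.Tendsto (fun n : ℕ => auxF ((n:ℝ) + 1) x) Filter.atTop
    (𝓝 (if 0 < x then 1 else 0)) := by
  split_ifs with h
  · apply tendsto_const_nhds.congr'
    obtain ⟨N, hN⟩ := exists_nat_gt (1 / x)
    filter_upwards [Filter.eventually_ge_atTop N] with n hn
    symm
    apply Real.smoothTransition.one_of_one_le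
    have : (N:ℝ) ≤ n := by exact_mod_cast hn
    have : 1 / x ≤ (n:ℝ) + 1 := by linarith
    rwa [div_le_iff₀ h] at this
  · apply tendsto_const_nhds.congr
    intro n
    symm
    apply Real.smoothTransition.zero_of_nonpos
    exact mul_nonpos_of_nonneg_of_nonpos (by positivity) (not_lt.1 h)

lemma auxX_tendsto {l : ℝ} (hl : 0 < l) (x : ℝ) :
    Filter.Tendsto (fun n : ℕ => auxX l ((n:ℝ) + 1) x) Filter.atTop
    (𝓝 ((Ioc 0 l).indicator 1 x)) := by
  have := (auxF_tendsto x).sub (auxF_tendsto (x - l))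
  have e : (Ioc 0 l).indicator (1 : ℝ → ℝ) x
      = (if 0 < x then 1 else 0) - (if 0 < x - l then 1 else 0) := by
    simp only [indicator, mem_Ioc, Pi.one_apply, sub_pos]
    split_ifs <;> first | (norm_num; done) | (exfalso; grind)
  rw [e]
  exact this

lemma aux_pd {a b : ℝ → ℝ} (ha : Differentiable ℝ a) (hb : Differentiable ℝ b) (p : ℝ × ℝ) :
    pd1 (fun p => a p.1 * b p.2) p = deriv a p.1 * b p.2 ∧
    pd2 (fun p => a p.1 * b p.2) p = a p.1 * deriv b p.2 := by
  have h1 : HasFDerivAt (fun p : ℝ × ℝ => a p.1) _ p :=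
    (ha p.1).hasDerivAt.hasFDerivAt.comp p hasFDerivAt_fst
  have h2 : HasFDerivAt (fun p : ℝ × ℝ => b p.2) _ p :=
    (hb p.2).hasDerivAt.hasFDerivAt.comp p hasFDerivAt_snd
  have := (h1.mul h2).fderiv
  constructor
  · unfold pd1
    erw [this]
    simp [mul_comm]
  · unfold pd2
    erw [this]
    simp

lemma aux_weak (l₁ : ℝ) (hl₁ : 0 < l₁) (s τ : ℝ × ℝ → ℝ)
    (hs : LocallyIntegrable s volume) (hτ : LocallyIntegrable τ volume)
    (hper : ∀ᵐ p : ℝ × ℝ ∂volume, s (p.1 + l₁, p.2) = s p)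
    (hdiv : ∀ φ : ℝ × ℝ → ℝ, ContDiff ℝ ∞ φ → HasCompactSupport φ →
      ∫ p : ℝ × ℝ, (s p * pd1 φ p + τ p * pd2 φ p) = 0)
    (ψ : ℝ → ℝ) (hψ : ContDiff ℝ ∞ ψ) (hψc : HasCompactSupport ψ) :
    ∫ y, (∫ x in Ioc 0 l₁, τ (x, y)) * deriv ψ y = 0 := by
  have cψ' : Continuous (deriv ψ) := hψ.continuous_deriv (by simp)
  have hk : ∀ n : ℕ, (1:ℝ) ≤ (n:ℝ) + 1 := fun n => by simp
  have key : ∀ n : ℕ, ∫ p : ℝ × ℝ, τ p * (auxX l₁ ((n:ℝ) + 1) p.1 * deriv ψ p.2) = 0 := by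
    intro n
    have sX := auxX_smooth l₁ ((n:ℝ) + 1)
    have hd := hdiv (fun p => auxX l₁ ((n:ℝ) + 1) p.1 * ψ p.2)
      ((sX.comp contDiff_fst).mul (hψ.comp contDiff_snd)) (aux_hcs (auxX_hcs hl₁ (hk n)) hψc)
    have e := aux_pd (sX.differentiable (by simp)) (hψ.differentiable (by simp))
    simp_rw [(e _).1, (e _).2] at hd
    rw [integral_add] at hd
    · simp_rw [auxX_deriv] at hd
      rw [aux_shift hs l₁ hper ((auxF_smooth _).continuous_deriv (by simp)) hψ.continuous
        (auxF_deriv_hcs (hk n)) hψc, zero_add] at hd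
      exact hd
    · exact aux_int hs (sX.continuous_deriv (by simp)) hψ.continuous
        (auxX_hcs hl₁ (hk n)).deriv hψc
    · exact aux_int hτ sX.continuous cψ' (auxX_hcs hl₁ (hk n)) hψc.deriv
  have cB : Continuous (fun x => auxX (l₁ + 2) 1 (x + 1)) :=
    (auxX_smooth _ _).continuous.comp (by fun_prop)
  have hB : HasCompactSupport (fun x => auxX (l₁ + 2) 1 (x + 1)) := by
    have := (auxX_hcs (l := l₁ + 2) (k := 1) (by linarith) le_rfl).comp_homeomorph
      (Homeomorph.addRight (1:ℝ))
    simpa [Function.comp_def] using this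
  have iB := (aux_int hτ cB cψ' hB hψc.deriv).norm
  have bd : ∀ n : ℕ, ∀ p : ℝ × ℝ, ‖τ p * (auxX l₁ ((n:ℝ) + 1) p.1 * deriv ψ p.2)‖
      ≤ ‖τ p * (auxX (l₁ + 2) 1 (p.1 + 1) * deriv ψ p.2)‖ := by
    intro n p
    simp only [norm_mul, Real.norm_eq_abs]
    refine mul_le_mul_of_nonneg_left (mul_le_mul_of_nonneg_right ?_ (abs_nonneg _)) (abs_nonneg _)
    exact (auxX_bound hl₁ (hk n) p.1).trans (le_abs_self _)
  have lim : ∀ p : ℝ × ℝ, Filter.Tendsto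
      (fun n : ℕ => τ p * (auxX l₁ ((n:ℝ) + 1) p.1 * deriv ψ p.2)) Filter.atTop
      (𝓝 (τ p * ((Ioc 0 l₁).indicator 1 p.1 * deriv ψ p.2))) := fun p =>
    ((auxX_tendsto hl₁ p.1).mul_const _).const_mul _
  have meas : ∀ n : ℕ, AEStronglyMeasurable
      (fun p : ℝ × ℝ => τ p * (auxX l₁ ((n:ℝ) + 1) p.1 * deriv ψ p.2)) volume := fun n =>
    (aux_int hτ (auxX_smooth _ _).continuous cψ' (auxX_hcs hl₁ (hk n)) hψc.deriv).1
  have T := tendsto_integral_of_dominated_convergence _ meas iB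
    (fun n => .of_forall (bd n)) (.of_forall lim)
  simp_rw [key] at T
  have Z := tendsto_nhds_unique T tendsto_const_nhds
  have iL : Integrable (fun p : ℝ × ℝ => τ p * ((Ioc 0 l₁).indicator 1 p.1 * deriv ψ p.2)) := by
    refine iB.mono' (aestronglyMeasurable_of_tendsto_ae _ meas (.of_forall lim)) ?_
    exact .of_forall fun p => le_of_tendsto (lim p).norm (.of_forall fun n => bd n p)
  rw [Measure.volume_eq_prod] at Z iL
  rw [integral_prod_symm _ iL] at Z
  refine Eq.trans ?_ Z
  congr 1; ext y
  rw [← integral_indicator measurableSet_Ioc, ← integral_mul_const]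
  congr 1; ext x
  by_cases hx : x ∈ Ioc 0 l₁ <;> simp [hx]

lemma aux_locint (l₁ : ℝ) (τ : ℝ × ℝ → ℝ) (hτ : LocallyIntegrable τ volume) :
    LocallyIntegrable (fun y => ∫ x in Ioc 0 l₁, τ (x, y)) volume := by
  rw [locallyIntegrable_iff]
  intro K hK
  have : IntegrableOn τ (Ioc 0 l₁ ×ˢ K) volume :=
    (hτ.integrableOn_isCompact (isCompact_Icc.prod hK)).mono_set
      (prod_mono_left Ioc_subset_Icc_self)
  rw [Measure.volume_eq_prod, IntegrableOn, ← Measure.prod_restrict] at this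
  exact this.integral_prod_right

lemma aux_contAt (l₁ : ℝ) (hl₁ : 0 < l₁) (τ : ℝ × ℝ → ℝ) (α : ℝ) (U : Set (ℝ × ℝ))
    (hU : IsOpen U) (hα : ∀ x : ℝ, (x, α) ∈ U) (hc : ContinuousOn τ U) :
    ContinuousAt (fun y => ∫ x in (0:ℝ)..l₁, τ (x, y)) α := by
  obtain ⟨u, v, -, hv, hu', hv', huv⟩ := generalized_tube_lemma (isCompact_Icc (a := 0) (b := l₁))
    (isCompact_singleton (x := α)) hU (by rintro ⟨x, y⟩ ⟨-, rfl⟩; exact hα x)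
  obtain ⟨δ, hδ, hball⟩ := Metric.isOpen_iff.1 hv α (hv' rfl)
  have hsub : Icc 0 l₁ ×ˢ Metric.closedBall α (δ / 2) ⊆ U :=
    (prod_mono hu' ((Metric.closedBall_subset_ball (by linarith)).trans hball)).trans huv
  obtain ⟨C, hC⟩ := (isCompact_Icc.prod (isCompact_closedBall α (δ / 2))).exists_bound_of_continuousOn
    (hc.mono hsub)
  have hnh : Metric.closedBall α (δ / 2) ∈ 𝓝 α := Metric.closedBall_mem_nhds _ (by linarith)
  apply intervalIntegral.continuousAt_of_dominated_interval (bound := fun _ => C)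
  · filter_upwards [hnh] with y hy
    rw [uIoc_of_le hl₁.le]
    apply ContinuousOn.aestronglyMeasurable _ measurableSet_Ioc
    refine hc.comp (by fun_prop) ?_
    intro x hx
    exact hsub ⟨Ioc_subset_Icc_self hx, hy⟩
  · filter_upwards [hnh] with y hy
    refine .of_forall fun x hx => ?_
    rw [uIoc_of_le hl₁.le] at hx
    exact hC _ ⟨Ioc_subset_Icc_self hx, hy⟩
  · simp
  · refine .of_forall fun x _ => ?_
    exact (hc.continuousAt (hU.mem_nhds (hα x))).comp (f := fun y : ℝ => (x, y)) (by fun_prop)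

/-- For a `Y`-periodic, distributionally divergence-free stress field that is continuous on a
neighborhood of the horizontal line `ℝ × {α}`, the cell average of `σ₂₂` equals its line
average over the horizontal segment. -/
theorem cell_average_eq_line_average_sigma22
    (l₁ l₂ : ℝ) (hl₁ : 0 < l₁) (hl₂ : 0 < l₂)
    (σ11 σ12 σ22 : ℝ × ℝ → ℝ)
    (hloc11 : LocallyIntegrable σ11 volume)
    (hloc12 : LocallyIntegrable σ12 volume)
    (hloc22 : LocallyIntegrable σ22 volume)
    (hper : ∀ᵐ p : ℝ × ℝ ∂volume,
      σ11 (p.1 + l₁, p.2) = σ11 p ∧ σ11 (p.1, p.2 + l₂) = σ11 p ∧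
      σ12 (p.1 + l₁, p.2) = σ12 p ∧ σ12 (p.1, p.2 + l₂) = σ12 p ∧
      σ22 (p.1 + l₁, p.2) = σ22 p ∧ σ22 (p.1, p.2 + l₂) = σ22 p)
    (hdiv : ∀ φ₁ φ₂ : ℝ × ℝ → ℝ, ContDiff ℝ (⊤ : ℕ∞) φ₁ → ContDiff ℝ (⊤ : ℕ∞) φ₂ →
      HasCompactSupport φ₁ → HasCompactSupport φ₂ →
      ∫ p : ℝ × ℝ, (σ11 p * pd1 φ₁ p + σ12 p * pd2 φ₁ p
        + σ12 p * pd1 φ₂ p + σ22 p * pd2 φ₂ p) = 0)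
    (α : ℝ)
    (hcont : ∃ U : Set (ℝ × ℝ), IsOpen U ∧ (∀ x : ℝ, (x, α) ∈ U) ∧
      ContinuousOn σ11 U ∧ ContinuousOn σ12 U ∧ ContinuousOn σ22 U) :
    (1 / (l₁ * l₂)) * ∫ p in Ioo (0:ℝ) l₁ ×ˢ Ioo (0:ℝ) l₂, σ22 p
      = (1 / l₁) * ∫ x in (0:ℝ)..l₁, σ22 (x, α) := by
  obtain ⟨U, hU, hα, -, -, hc⟩ := hcont
  have hw := aux_weak l₁ hl₁ σ12 σ22 hloc12 hloc22 (hper.mono fun p hp => hp.2.2.1)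
    (fun φ h1 h2 => by
      have := hdiv (fun _ => 0) φ contDiff_const h1 HasCompactSupport.zero h2
      simpa [pd1, pd2] using this)
  obtain ⟨c, hcst⟩ := aux_const (aux_locint l₁ σ22 hloc22) hw
  have hca := aux_contAt l₁ hl₁ σ22 α U hU hα hc
  have hline : ∫ x in (0:ℝ)..l₁, σ22 (x, α) = c := by
    by_contra hne
    have hev := hca.eventually_ne hne
    have hpos := Measure.measure_pos_of_mem_nhds volume hev
    refine hpos.ne' (measure_mono_null ?_ hcst)
    intro y hy
    simp only [Set.mem_ofPred_eq] at hy
    rw [intervalIntegral.integral_of_le hl₁.le] at hy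
    exact hy
  have hcell : ∫ p in Ioo (0:ℝ) l₁ ×ˢ Ioo (0:ℝ) l₂, σ22 p = l₂ * c := by
    have : IntegrableOn σ22 (Ioo (0:ℝ) l₁ ×ˢ Ioo (0:ℝ) l₂) volume :=
      (hloc22.integrableOn_isCompact (isCompact_Icc.prod isCompact_Icc)).mono_set
        (prod_mono Ioo_subset_Icc_self Ioo_subset_Icc_self)
    rw [Measure.volume_eq_prod, IntegrableOn, ← Measure.prod_restrict] at this
    rw [Measure.volume_eq_prod, ← Measure.prod_restrict, integral_prod_symm _ this]
    have e : ∀ᵐ y ∂(volume.restrict (Ioo (0:ℝ) l₂)), ∫ x in Ioo (0:ℝ) l₁, σ22 (x, y) = c := by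
      filter_upwards [ae_restrict_of_ae hcst] with y hy
      rw [← integral_Ioc_eq_integral_Ioo, hy]
    rw [integral_congr_ae e]
    simp [hl₂.le]
  rw [hline, hcell]
  field_simp
end

section
/- Let σ be a Y-periodic stress field on ℝ², divergence-free in the sense of distributions, continuous on an open neighborhood of the horizontal line ℝ × {α} for some α ∈ ℝ. Suppose there are c ∈ ℝ, an open set V ⊆ ℝ² containing the segment γ₁ = [c, c+l₁] × {α}, a C¹ map u : V → ℝ² whose strain ε(u) satisfies Hooke's law with moduli K, G > 0 relative to σ on V, and a real number ξ₁₁ with u₁(c+l₁, α) − u₁(c, α) = ξ₁₁ l₁. Then ξ₁₁ = (1/(4K))( ⨍_{γ₁} σ₁₁ + ⨍_Y σ₂₂ ) + (1/(4G))( ⨍_{γ₁} σ₁₁ − ⨍_Y σ₂₂ ), where ⨍_{γ₁} σ₁₁ = (1/l₁)∫_c^{c+l₁} σ₁₁(x, α) dx and ⨍_Y σ₂₂ = (1/(l₁l₂))∫_Y σ₂₂ dx. -/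
open MeasureTheory Set

/-- Strain component `ε₁₁` of a displacement field `u`. -/
noncomputable def eps11 (u : ℝ × ℝ → ℝ × ℝ) (p : ℝ × ℝ) : ℝ := pd1 (fun q => (u q).1) p

/-- Strain component `ε₂₂` of a displacement field `u`. -/
noncomputable def eps22 (u : ℝ × ℝ → ℝ × ℝ) (p : ℝ × ℝ) : ℝ := pd2 (fun q => (u q).2) p

/-- Strain component `ε₁₂` of a displacement field `u`. -/
noncomputable def eps12 (u : ℝ × ℝ → ℝ × ℝ) (p : ℝ × ℝ) : ℝ :=
  (1 / 2) * (pd2 (fun q => (u q).1) p + pd1 (fun q => (u q).2) p)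


def BC1 (g : ℝ → ℝ) : Prop := Measurable g ∧ ∃ C R : ℝ, ∀ x, |g x| ≤ C ∧ (R < |x| → g x = 0)
def StepL (g : ℝ → ℝ) : Prop :=
  Measurable g ∧ ∃ C R : ℝ, ∀ x, |g x| ≤ C ∧ (x < -R → g x = 0) ∧ (R < x → g x = 1)

lemma BC1.integrable_mul {f : ℝ × ℝ → ℝ} (hf : LocallyIntegrable f volume) {g k : ℝ → ℝ}
    (hg : BC1 g) (hk : BC1 k) : Integrable (fun p : ℝ × ℝ => f p * (g p.1 * k p.2)) := by
  obtain ⟨mg, C, R, h1⟩ := hg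
  obtain ⟨mk, C', R', h2⟩ := hk
  have hK : IsCompact ((Icc (-R) R) ×ˢ (Icc (-R') R')) := isCompact_Icc.prod isCompact_Icc
  have hi := hf.integrableOn_isCompact hK
  have m : Measurable (fun p : ℝ × ℝ => g p.1 * k p.2) :=
    (mg.comp measurable_fst).mul (mk.comp measurable_snd)
  have hi2 : IntegrableOn (fun p : ℝ × ℝ => f p * (g p.1 * k p.2))
      ((Icc (-R) R) ×ˢ (Icc (-R') R')) := by
    refine Integrable.mul_bdd (c := C * C') hi m.aestronglyMeasurable (Filter.Eventually.of_forall fun p => ?_)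
    rw [Real.norm_eq_abs, abs_mul]
    exact mul_le_mul (h1 _).1 (h2 _).1 (abs_nonneg _) ((abs_nonneg _).trans (h1 p.1).1)
  refine (integrableOn_iff_integrable_of_support_subset ?_).1 hi2
  intro p hp
  simp only [Function.mem_support, ne_eq, mul_eq_zero, not_or] at hp
  refine ⟨abs_le.1 ?_, abs_le.1 ?_⟩
  · by_contra h; exact hp.2.1 ((h1 _).2 (not_le.1 h))
  · by_contra h; exact hp.2.2 ((h2 _).2 (not_le.1 h))

lemma StepL.sub {g k : ℝ → ℝ} (hg : StepL g) (hk : StepL k) : BC1 (fun x => g x - k x) := by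
  obtain ⟨mg, C, R, h1⟩ := hg
  obtain ⟨mk, C', R', h2⟩ := hk
  refine ⟨mg.sub mk, C + C', max R R', fun x => ⟨(abs_sub _ _).trans (add_le_add (h1 x).1 (h2 x).1), fun h => ?_⟩⟩
  obtain ⟨ha, hb⟩ := max_lt_iff.1 h
  rcases le_total 0 x with hx | hx
  · rw [abs_of_nonneg hx] at ha hb
    show g x - k x = 0
    rw [(h1 x).2.2 ha, (h2 x).2.2 hb, sub_self]
  · rw [abs_of_nonpos hx] at ha hb
    show g x - k x = 0
    rw [(h1 x).2.1 (by linarith), (h2 x).2.1 (by linarith), sub_self]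

lemma StepL.shift {g : ℝ → ℝ} (hg : StepL g) (l : ℝ) : StepL (fun x => g (x - l)) := by
  obtain ⟨mg, C, R, h1⟩ := hg
  refine ⟨mg.comp (measurable_id.sub_const l), C, R + |l|, fun x => ⟨(h1 _).1, fun h => (h1 _).2.1 ?_, fun h => (h1 _).2.2 ?_⟩⟩
  · have := neg_abs_le l; linarith
  · have := le_abs_self l; linarith

lemma BC1.shift {g : ℝ → ℝ} (hg : BC1 g) (l : ℝ) : BC1 (fun x => g (x - l)) := by
  obtain ⟨mg, C, R, h1⟩ := hg
  refine ⟨mg.comp (measurable_id.sub_const l), C, R + |l|, fun x => ⟨(h1 _).1, fun h => (h1 _).2 ?_⟩⟩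
  have := abs_sub_abs_le_abs_sub x l; linarith

lemma BC1.of_cont {g : ℝ → ℝ} (hg : Continuous g) (R : ℝ) (h : ∀ x, R < |x| → g x = 0) : BC1 g := by
  obtain ⟨C, hC⟩ := (isCompact_Icc (a := -R) (b := R)).exists_bound_of_continuousOn hg.continuousOn
  refine ⟨hg.measurable, max C 0, R, fun x => ⟨?_, h x⟩⟩
  by_cases hx : R < |x|
  · simp [h x hx]
  · exact (hC x (abs_le.1 (not_lt.1 hx))).trans (le_max_left _ _)

lemma StepL.ici (c : ℝ) : StepL (indicator (Ici c) (fun _ => (1:ℝ))) := by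
  refine ⟨measurable_const.indicator measurableSet_Ici, 1, |c|, fun x => ⟨?_, fun h => ?_, fun h => ?_⟩⟩
  · by_cases hx : x ∈ Ici c <;> simp [hx]
  · have := neg_abs_le c
    exact indicator_of_notMem (by simp; linarith) _
  · have := le_abs_self c
    exact indicator_of_mem (by simp; linarith) _

lemma trans_int {f : ℝ × ℝ → ℝ} (v : ℝ × ℝ) (hf : ∀ᵐ p : ℝ × ℝ, f (p + v) = f p) (F : ℝ × ℝ → ℝ) :
    ∫ p, f p * F (p - v) = ∫ p, f p * F p := by
  rw [← integral_add_right_eq_self (fun p => f p * F (p - v)) v]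
  refine integral_congr_ae ?_
  filter_upwards [hf] with p hp
  simp [hp]

lemma step_x {f : ℝ × ℝ → ℝ} (hl : LocallyIntegrable f volume) (l : ℝ)
    (hf : ∀ᵐ p : ℝ × ℝ, f (p + (l, 0)) = f p) {J1 J2 k : ℝ → ℝ} (h1 : StepL J1) (h2 : StepL J2)
    (hk : BC1 k) :
    ∫ p, f p * ((J1 p.1 - J1 (p.1 - l)) * k p.2) = ∫ p, f p * ((J2 p.1 - J2 (p.1 - l)) * k p.2) := by
  rw [← sub_eq_zero, ← integral_sub ((h1.sub (h1.shift l)).integrable_mul hl hk)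
    ((h2.sub (h2.shift l)).integrable_mul hl hk)]
  have := trans_int (l, 0) hf (fun p => (J1 p.1 - J2 p.1) * k p.2)
  rw [← sub_eq_zero, ← integral_sub] at this
  · rw [← neg_eq_zero, ← integral_neg, ← this]
    congr 1; ext p; simp; ring
  · simpa using ((h1.sub h2).shift l).integrable_mul hl hk
  · exact (h1.sub h2).integrable_mul hl hk

lemma step_y {f : ℝ × ℝ → ℝ} (hl : LocallyIntegrable f volume) (l : ℝ)
    (hf : ∀ᵐ p : ℝ × ℝ, f (p + (0, l)) = f p) {J1 J2 k : ℝ → ℝ} (h1 : StepL J1) (h2 : StepL J2)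
    (hk : BC1 k) :
    ∫ p, f p * (k p.1 * (J1 p.2 - J1 (p.2 - l))) = ∫ p, f p * (k p.1 * (J2 p.2 - J2 (p.2 - l))) := by
  rw [← sub_eq_zero, ← integral_sub (hk.integrable_mul hl (h1.sub (h1.shift l)))
    (hk.integrable_mul hl (h2.sub (h2.shift l)))]
  have := trans_int (0, l) hf (fun p => k p.1 * (J1 p.2 - J2 p.2))
  rw [← sub_eq_zero, ← integral_sub] at this
  · rw [← neg_eq_zero, ← integral_neg, ← this]
    congr 1; ext p; simp; ring
  · simpa using hk.integrable_mul hl ((h1.sub h2).shift l)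
  · exact hk.integrable_mul hl (h1.sub h2)

lemma ici_sub (c l : ℝ) (hl : 0 < l) (x : ℝ) : indicator (Ici c) (fun _ => (1:ℝ)) x -
    indicator (Ici c) (fun _ => (1:ℝ)) (x - l) = indicator (Ico c (c + l)) (fun _ => (1:ℝ)) x := by
  simp only [indicator_apply, mem_Ici, mem_Ico]
  split_ifs <;> grind

noncomputable def hh : ℝ → ℝ := deriv Real.smoothTransition

lemma hasDerivAt_H (x : ℝ) : HasDerivAt Real.smoothTransition (hh x) x :=
  ((Real.smoothTransition.contDiff (n := 1)).differentiable (by simp) x).hasDerivAt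

lemma cont_hh : Continuous hh :=
  (Real.smoothTransition.contDiff (n := 1)).continuous_deriv (by simp)

lemma hh_nonneg (x : ℝ) : 0 ≤ hh x := Real.smoothTransition.monotone.deriv_nonneg

lemma hh_zero {x : ℝ} (h : x < 0 ∨ 1 < x) : hh x = 0 := by
  rcases h with h | h
  · have : Real.smoothTransition =ᶠ[nhds x] fun _ => 0 := by
      filter_upwards [Iio_mem_nhds h] with y hy
      exact Real.smoothTransition.zero_of_nonpos (le_of_lt hy)
    simp [hh, this.deriv_eq]
  · have : Real.smoothTransition =ᶠ[nhds x] fun _ => 1 := by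
      filter_upwards [Ioi_mem_nhds h] with y hy
      exact Real.smoothTransition.one_of_one_le (le_of_lt hy)
    simp [hh, this.deriv_eq]

lemma bc_hh : BC1 hh := by
  refine BC1.of_cont cont_hh 1 fun x hx => hh_zero ?_
  rcases le_total 0 x with h | h
  · rw [abs_of_nonneg h] at hx; exact Or.inr hx
  · rw [abs_of_nonpos h] at hx; left; linarith

lemma step_H : StepL Real.smoothTransition :=
  ⟨Real.smoothTransition.continuous.measurable, 1, 1, fun x =>
    ⟨by rw [abs_of_nonneg (Real.smoothTransition.nonneg x)]; exact Real.smoothTransition.le_one x,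
     fun h => Real.smoothTransition.zero_of_nonpos (by linarith),
     fun h => Real.smoothTransition.one_of_one_le h.le⟩⟩

noncomputable def Ht (x : ℝ) : ℝ := Real.smoothTransition x + x * hh x

lemma bc_xhh : BC1 (fun x => x * hh x) := by
  refine BC1.of_cont (continuous_id.mul cont_hh) 1 fun x hx => ?_
  rw [hh_zero, mul_zero]
  rcases le_total 0 x with h | h
  · rw [abs_of_nonneg h] at hx; exact Or.inr hx
  · rw [abs_of_nonpos h] at hx; left; linarith

lemma step_Ht : StepL Ht := by
  obtain ⟨m1, C, R, h1⟩ := step_H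
  obtain ⟨m2, C', R', h2⟩ := bc_xhh
  refine ⟨m1.add m2, C + C', max R R', fun x => ⟨(abs_add_le _ _).trans (add_le_add (h1 x).1 (h2 x).1), fun h => ?_, fun h => ?_⟩⟩
  · have := le_max_left R R'; have := le_max_right R R'
    rw [Ht, (h1 x).2.1 (by linarith), zero_add]
    exact (h2 x).2 (lt_abs.2 (Or.inr (by linarith)))
  · have := le_max_left R R'; have := le_max_right R R'
    have h3 := (h2 x).2 (lt_abs.2 (Or.inl (by linarith)))
    beta_reduce at h3
    rw [Ht, (h1 x).2.2 (by linarith), h3, add_zero]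

noncomputable def kap (a δ y : ℝ) : ℝ := hh ((y - a) / δ) * (1 / δ)

lemma kap_zero {a δ y : ℝ} (hδ : 0 < δ) (h : y < a ∨ a + δ < y) : kap a δ y = 0 := by
  rw [kap, hh_zero, zero_mul]
  rcases h with h | h
  · left; exact div_neg_of_neg_of_pos (by linarith) hδ
  · right; rw [lt_div_iff₀ hδ]; linarith

lemma kap_nonneg {a δ y : ℝ} (hδ : 0 < δ) : 0 ≤ kap a δ y :=
  mul_nonneg (hh_nonneg _) (by positivity)

lemma cont_kap (a δ : ℝ) : Continuous (kap a δ) := by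
  unfold kap
  exact (cont_hh.comp (by fun_prop : Continuous fun y : ℝ => (y - a) / δ)).mul continuous_const

lemma bc_kap {a δ : ℝ} (hδ : 0 < δ) : BC1 (kap a δ) := by
  refine BC1.of_cont (cont_kap a δ) (|a| + δ) fun x hx => kap_zero hδ ?_
  by_contra! h
  have h1 := neg_abs_le a
  have h2 := le_abs_self a
  exact absurd hx (not_lt.2 (abs_le.2 ⟨by linarith, by linarith⟩))

lemma kap_deriv (a δ y : ℝ) :
    HasDerivAt (fun y => Real.smoothTransition ((y - a) / δ)) (kap a δ y) y := by
  have := (((hasDerivAt_id y).sub_const a).div_const δ)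
  exact (hasDerivAt_H ((y - a) / δ)).comp y this

lemma int_kap {a δ : ℝ} (hδ : 0 < δ) : ∫ y, kap a δ y = 1 := by
  have h1 : ∫ y in a..(a + δ), kap a δ y = 1 := by
    rw [intervalIntegral.integral_eq_sub_of_hasDerivAt (fun y _ => kap_deriv a δ y)
      ((cont_kap a δ).intervalIntegrable _ _)]
    simp [hδ.ne']
  rw [← h1, intervalIntegral.integral_of_le (by linarith), ← integral_Icc_eq_integral_Ioc,
    setIntegral_eq_integral_of_forall_compl_eq_zero]
  intro x hx
  apply kap_zero hδ
  by_contra! h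
  exact hx h

lemma int_kap_int {a δ : ℝ} (hδ : 0 < δ) : Integrable (kap a δ) := by
  by_contra h
  have := int_kap (a := a) hδ
  rw [integral_undef h] at this
  exact zero_ne_one this

lemma weak_id {l₁ l₂ : ℝ} {σ12 σ22 : ℝ × ℝ → ℝ}
    (h12 : LocallyIntegrable σ12 volume) (h22 : LocallyIntegrable σ22 volume)
    (p12 : ∀ᵐ p : ℝ × ℝ, σ12 (p + (l₁, 0)) = σ12 p)
    (hdiv : ∀ φ : ℝ × ℝ → ℝ, ContDiff ℝ (⊤ : ℕ∞) φ → HasCompactSupport φ →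
      ∫ p : ℝ × ℝ, (σ12 p * pd1 φ p + σ22 p * pd2 φ p) = 0) (a δ : ℝ) (hδ : 0 < δ) :
    ∫ p, σ22 p * ((Real.smoothTransition p.1 - Real.smoothTransition (p.1 - l₁)) *
      (l₂ * kap a δ p.2 - (Ht p.2 - Ht (p.2 - l₂)))) = 0 := by
  set H := Real.smoothTransition with hH
  have cH : ContDiff ℝ (⊤ : ℕ∞) H := Real.smoothTransition.contDiff
  let χ : ℝ → ℝ := fun x => H x - H (x - l₁)
  let ψ : ℝ → ℝ := fun y => l₂ * H ((y - a) / δ) - (y * H y - (y - l₂) * H (y - l₂))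
  have cχ : ContDiff ℝ (⊤ : ℕ∞) χ := cH.sub (cH.comp (contDiff_id.sub contDiff_const))
  have cψ : ContDiff ℝ (⊤ : ℕ∞) ψ :=
    (contDiff_const.mul (cH.comp ((contDiff_id.sub contDiff_const).div_const δ))).sub
      ((contDiff_id.mul cH).sub ((contDiff_id.sub contDiff_const).mul
        (cH.comp (contDiff_id.sub contDiff_const))))
  have dχ : ∀ x, HasDerivAt χ (hh x - hh (x - l₁)) x := fun x =>
    (hasDerivAt_H x).sub ((hasDerivAt_H (x - l₁)).comp_sub_const x l₁)
  have dM : ∀ x, HasDerivAt (fun y => y * H y) (Ht x) x := fun x => by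
    have : HasDerivAt (fun y => y * H y) (1 * H x + x * hh x) x :=
      (hasDerivAt_id x).mul (hasDerivAt_H x)
    rw [one_mul] at this
    exact this
  have dψ : ∀ y, HasDerivAt ψ (l₂ * kap a δ y - (Ht y - Ht (y - l₂))) y := fun y =>
    ((kap_deriv a δ y).const_mul l₂).sub ((dM y).sub ((dM (y - l₂)).comp_sub_const y l₂))
  have zχ : BC1 χ := step_H.sub (step_H.shift l₁)
  have zψ : BC1 ψ := by
    refine BC1.of_cont cψ.continuous (|a| + δ + 1 + |l₂|) fun y hy => ?_
    have h1 := neg_abs_le a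
    have h2 := le_abs_self a
    have h3 := neg_abs_le l₂
    have h4 := le_abs_self l₂
    have h5 := abs_nonneg a
    have h6 := abs_nonneg l₂
    simp only [ψ]
    rcases lt_abs.1 hy with h | h
    · rw [hH, Real.smoothTransition.one_of_one_le (by rw [le_div_iff₀ hδ]; linarith),
        Real.smoothTransition.one_of_one_le (by linarith),
        Real.smoothTransition.one_of_one_le (by linarith)]
      ring
    · rw [hH, Real.smoothTransition.zero_of_nonpos
          (div_nonpos_of_nonpos_of_nonneg (by linarith) hδ.le),
        Real.smoothTransition.zero_of_nonpos (by linarith),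
        Real.smoothTransition.zero_of_nonpos (by linarith)]
      ring
  have hs : HasCompactSupport (fun p : ℝ × ℝ => χ p.1 * ψ p.2) := by
    obtain ⟨-, C, R, h1⟩ := zχ
    obtain ⟨-, C', R', h2⟩ := zψ
    refine HasCompactSupport.intro (isCompact_Icc.prod isCompact_Icc :
      IsCompact ((Icc (-R) R) ×ˢ (Icc (-R') R'))) fun p hp => ?_
    by_contra hne
    rw [mul_eq_zero, not_or] at hne
    apply hp
    refine ⟨abs_le.1 ?_, abs_le.1 ?_⟩
    · by_contra h; exact hne.1 ((h1 _).2 (not_le.1 h))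
    · by_contra h; exact hne.2 ((h2 _).2 (not_le.1 h))
  have hφ := hdiv (fun p => χ p.1 * ψ p.2)
    ((cχ.comp contDiff_fst).mul (cψ.comp contDiff_snd)) hs
  have hfd : ∀ p : ℝ × ℝ, HasFDerivAt (fun p : ℝ × ℝ => χ p.1 * ψ p.2) _ p := fun p =>
    ((dχ p.1).hasFDerivAt.comp p hasFDerivAt_fst).mul ((dψ p.2).hasFDerivAt.comp p hasFDerivAt_snd)
  have e1 : ∀ p, pd1 (fun p : ℝ × ℝ => χ p.1 * ψ p.2) p = (hh p.1 - hh (p.1 - l₁)) * ψ p.2 := by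
    intro p
    rw [pd1, (hfd p).fderiv]
    simp
    ring
  have e2 : ∀ p, pd2 (fun p : ℝ × ℝ => χ p.1 * ψ p.2) p =
      χ p.1 * (l₂ * kap a δ p.2 - (Ht p.2 - Ht (p.2 - l₂))) := by
    intro p
    rw [pd2, (hfd p).fderiv]
    simp
  have z' : BC1 (fun y => l₂ * kap a δ y - (Ht y - Ht (y - l₂))) := by
    obtain ⟨m, C, R, h1⟩ := bc_kap (a := a) hδ
    obtain ⟨m', C', R', h2⟩ := step_Ht.sub (step_Ht.shift l₂)
    refine ⟨(m.const_mul l₂).sub m', |l₂| * C + C', max R R', fun x => ⟨?_, fun h => ?_⟩⟩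
    · refine (abs_sub _ _).trans (add_le_add ?_ (h2 x).1)
      rw [abs_mul]; exact mul_le_mul_of_nonneg_left (h1 x).1 (abs_nonneg _)
    · obtain ⟨ha, hb⟩ := max_lt_iff.1 h
      have := (h2 x).2 hb
      beta_reduce at this ⊢
      rw [this, (h1 x).2 ha]; simp
  have z1 : BC1 (fun x => hh x - hh (x - l₁)) := by
    obtain ⟨m, C, R, h1⟩ := bc_hh
    obtain ⟨m', C', R', h2⟩ := bc_hh.shift l₁
    refine ⟨m.sub m', C + C', max R R', fun x =>
      ⟨(abs_sub _ _).trans (add_le_add (h1 x).1 (h2 x).1), fun h => ?_⟩⟩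
    obtain ⟨ha, hb⟩ := max_lt_iff.1 h
    have := (h2 x).2 hb
    beta_reduce at this ⊢
    rw [this, (h1 x).2 ha]; simp
  simp only [e1, e2] at hφ
  rw [integral_add (z1.integrable_mul h12 zψ) (zχ.integrable_mul h22 z')] at hφ
  have t := trans_int (l₁, 0) p12 (fun p => hh p.1 * ψ p.2)
  have t0 : ∫ p, σ12 p * ((hh p.1 - hh (p.1 - l₁)) * ψ p.2) = 0 := by
    simp only [Prod.fst_sub, Prod.snd_sub, sub_zero] at t
    rw [← sub_eq_zero.2 t.symm, ← integral_sub (bc_hh.integrable_mul h12 zψ)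
      ((bc_hh.shift l₁).integrable_mul h12 zψ)]
    congr 1; ext p; ring
  rw [t0, zero_add] at hφ
  exact hφ

lemma cell_id {l₁ l₂ : ℝ} (hl₁ : 0 < l₁) (hl₂ : 0 < l₂) {σ12 σ22 : ℝ × ℝ → ℝ}
    (h12 : LocallyIntegrable σ12 volume) (h22 : LocallyIntegrable σ22 volume)
    (p12 : ∀ᵐ p : ℝ × ℝ, σ12 (p + (l₁, 0)) = σ12 p)
    (p22 : ∀ᵐ p : ℝ × ℝ, σ22 (p + (l₁, 0)) = σ22 p)
    (p22' : ∀ᵐ p : ℝ × ℝ, σ22 (p + (0, l₂)) = σ22 p)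
    (hdiv : ∀ φ : ℝ × ℝ → ℝ, ContDiff ℝ (⊤ : ℕ∞) φ → HasCompactSupport φ →
      ∫ p : ℝ × ℝ, (σ12 p * pd1 φ p + σ22 p * pd2 φ p) = 0) (a c δ : ℝ) (hδ : 0 < δ) :
    l₂ * ∫ p, σ22 p * (indicator (Ico c (c + l₁)) (fun _ => (1:ℝ)) p.1 * kap a δ p.2) =
      ∫ p in Ioo (0:ℝ) l₁ ×ˢ Ioo (0:ℝ) l₂, σ22 p := by
  have h := weak_id (l₂ := l₂) h12 h22 p12 hdiv a δ hδ
  have zH := step_H.sub (step_H.shift l₁)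
  have zK := bc_kap (a := a) hδ
  have zT := step_Ht.sub (step_Ht.shift l₂)
  have e : ∀ p : ℝ × ℝ, σ22 p * ((Real.smoothTransition p.1 - Real.smoothTransition (p.1 - l₁)) *
      (l₂ * kap a δ p.2 - (Ht p.2 - Ht (p.2 - l₂)))) =
      l₂ * (σ22 p * ((Real.smoothTransition p.1 - Real.smoothTransition (p.1 - l₁)) * kap a δ p.2))
      - σ22 p * ((Real.smoothTransition p.1 - Real.smoothTransition (p.1 - l₁)) *
        (Ht p.2 - Ht (p.2 - l₂))) := fun p => by ring
  simp only [e] at h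
  rw [integral_sub ((zH.integrable_mul h22 zK).const_mul l₂) (zH.integrable_mul h22 zT),
    integral_const_mul, sub_eq_zero,
    step_x h22 l₁ p22 step_H (StepL.ici c) zK, step_x h22 l₁ p22 step_H (StepL.ici 0) zT,
    step_y h22 l₂ p22' step_Ht (StepL.ici 0) ((StepL.ici 0).sub ((StepL.ici 0).shift l₁))] at h
  simp only [ici_sub _ _ hl₁, ici_sub _ _ hl₂, zero_add] at h
  rw [h]
  have hae : (Ioo (0:ℝ) l₁ ×ˢ Ioo (0:ℝ) l₂ : Set (ℝ × ℝ)) =ᵐ[volume]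
      (Ico (0:ℝ) l₁ ×ˢ Ico (0:ℝ) l₂ : Set (ℝ × ℝ)) :=
    Measure.set_prod_ae_eq Ioo_ae_eq_Ico Ioo_ae_eq_Ico
  rw [setIntegral_congr_set hae, ← integral_indicator (measurableSet_Ico.prod measurableSet_Ico)]
  congr 1; ext p
  simp only [indicator_apply, mem_prod]
  split_ifs <;> simp_all

lemma line_id {l : ℝ} (hl : 0 < l) {f : ℝ × ℝ → ℝ} (hf : LocallyIntegrable f volume)
    (a c : ℝ) {U : Set (ℝ × ℝ)} (hU : IsOpen U) (hm : ∀ x, (x, a) ∈ U) (hc : ContinuousOn f U)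
    (I : ℝ)
    (h : ∀ δ > 0, ∫ p, f p * (indicator (Ico c (c + l)) (fun _ => (1:ℝ)) p.1 * kap a δ p.2) = I) :
    ∫ x in c..(c + l), f (x, a) = I := by
  have hca : Continuous (fun x => f (x, a)) :=
    hc.comp_continuous (by fun_prop) hm
  have eI : ∫ x in c..(c + l), f (x, a) =
      ∫ x, indicator (Ico c (c + l)) (fun x => f (x, a)) x := by
    rw [intervalIntegral.integral_of_le (by linarith), integral_indicator measurableSet_Ico,
      integral_Ico_eq_integral_Ioc]
  have bI : BC1 (indicator (Ico c (c + l)) (fun _ => (1:ℝ))) := by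
    have := (StepL.ici c).sub ((StepL.ici c).shift l)
    simpa only [ici_sub _ _ hl] using this
  have iI : Integrable (indicator (Ico c (c + l)) (fun x => f (x, a))) := by
    rw [integrable_indicator_iff measurableSet_Ico]
    exact (hca.integrableOn_Icc (a := c) (b := c + l)).mono_set Ico_subset_Icc_self
  have i1 : Integrable (indicator (Ico c (c + l)) (fun _ : ℝ => (1:ℝ))) := by
    rw [integrable_indicator_iff measurableSet_Ico]
    simp
  refine eq_of_forall_dist_le fun ε hε => ?_
  rw [Real.dist_eq]
  have hε' : 0 < ε / l := div_pos hε hl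
  -- uniform continuity near the segment
  obtain ⟨δ, hδ, hb⟩ : ∃ δ > 0, ∀ x ∈ Icc c (c + l), ∀ y ∈ Icc a (a + δ),
      |f (x, y) - f (x, a)| ≤ ε / l := by
    have hW : ∀ᶠ y in nhds a, ∀ x ∈ Icc c (c + l), |f (x, y) - f (x, a)| ≤ ε / l := by
      refine (isCompact_Icc (a := c) (b := c + l)).eventually_forall_of_forall_eventually ?_
      intro x hx
      have h1 : ContinuousAt f (x, a) := hc.continuousAt (hU.mem_nhds (hm x))
      have h2 : ContinuousAt (fun z : ℝ × ℝ => |f (z.2, z.1) - f (z.2, a)|) (a, x) := by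
        refine (ContinuousAt.sub ?_ ?_).abs
        · exact ContinuousAt.comp (f := fun z : ℝ × ℝ => (z.2, z.1)) (x := (a, x)) h1
            (by fun_prop)
        · exact (hca.comp continuous_snd).continuousAt
      have h3 := h2.eventually_lt (continuousAt_const (y := ε / l)) (by simpa using hε')
      have h4 : ∀ᶠ z : ℝ × ℝ in nhds (a, x), |f (z.2, z.1) - f (z.2, a)| ≤ ε / l :=
        h3.mono fun z hz => hz.le
      first
        | exact h4
        | exact (continuous_swap.tendsto (x, a)).eventually h4
    obtain ⟨r, hr, hr'⟩ := Metric.eventually_nhds_iff.1 hW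
    refine ⟨r / 2, by linarith, fun x hx y hy => hr' ?_ x hx⟩
    rw [Real.dist_eq, abs_lt]
    constructor <;> linarith [hy.1, hy.2]
  rw [eI, ← h δ hδ]
  have e2 : ∫ x, indicator (Ico c (c + l)) (fun x => f (x, a)) x =
      ∫ p : ℝ × ℝ, indicator (Ico c (c + l)) (fun x => f (x, a)) p.1 * kap a δ p.2 := by
    rw [Measure.volume_eq_prod, integral_prod_mul, int_kap hδ, mul_one]
  have e3 : ε = ∫ p : ℝ × ℝ, ε / l * (indicator (Ico c (c + l)) (fun _ => (1:ℝ)) p.1 * kap a δ p.2) := by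
    rw [integral_const_mul, Measure.volume_eq_prod, integral_prod_mul, int_kap hδ, mul_one,
      integral_indicator measurableSet_Ico]
    simp [hl.le]
    field_simp
  have j1 : Integrable (fun p : ℝ × ℝ =>
      indicator (Ico c (c + l)) (fun x => f (x, a)) p.1 * kap a δ p.2) volume :=
    iI.mul_prod (int_kap_int hδ)
  rw [e2, ← integral_sub j1 (bI.integrable_mul hf (bc_kap hδ))]
  refine (abs_integral_le_integral_abs).trans ?_
  rw [e3]
  refine integral_mono_of_nonneg (Filter.Eventually.of_forall fun p => abs_nonneg _)
    ((i1.mul_prod (int_kap_int hδ)).const_mul _) (Filter.Eventually.of_forall fun p => ?_)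
  beta_reduce
  by_cases hx : p.1 ∈ Ico c (c + l)
  · simp only [indicator_of_mem hx, one_mul]
    by_cases hy : p.2 ∈ Icc a (a + δ)
    · have := hb p.1 (Ico_subset_Icc_self hx) p.2 hy
      rw [← sub_mul, abs_mul, abs_of_nonneg (kap_nonneg hδ), abs_sub_comm]
      exact mul_le_mul_of_nonneg_right this (kap_nonneg hδ)
    · rw [kap_zero hδ]
      · simp
      · by_contra! h'; exact hy h'
  · simp [indicator_of_notMem hx]

lemma ftc_id {l a c : ℝ} (hl : 0 < l) {V : Set (ℝ × ℝ)} (hV : IsOpen V)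
    (hs : Icc c (c + l) ×ˢ ({a} : Set ℝ) ⊆ V) {u : ℝ × ℝ → ℝ × ℝ} (hu : ContDiffOn ℝ 1 u V)
    {g : ℝ → ℝ} (hg : Continuous g) (he : ∀ x ∈ Icc c (c + l), eps11 u (x, a) = g x) :
    (u (c + l, a)).1 - (u (c, a)).1 = ∫ x in c..(c + l), g x := by
  symm
  refine intervalIntegral.integral_eq_sub_of_hasDerivAt (f := fun x => (u (x, a)).1) ?_
    (hg.intervalIntegrable _ _)
  intro x hx
  rw [uIcc_of_le (by linarith)] at hx
  have hxV : (x, a) ∈ V := hs ⟨hx, rfl⟩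
  have hd : DifferentiableAt ℝ (fun q => (u q).1) (x, a) :=
    ((hu.differentiableOn (by simp)).differentiableAt (hV.mem_nhds hxV)).fst
  have h1 : HasDerivAt (fun x : ℝ => (x, a)) ((1:ℝ), (0:ℝ)) x :=
    (hasDerivAt_id x).prodMk (hasDerivAt_const x a)
  have := hd.hasFDerivAt.comp_hasDerivAt x h1
  rw [← he x hx]
  exact this

/-- Representation of the quasiperiod `ξ₁₁` in terms of the line average of `σ₁₁` over the
horizontal segment `γ₁` and the cell average of `σ₂₂`. -/
theorem quasiperiod_xi11_representation
    (l₁ l₂ : ℝ) (hl₁ : 0 < l₁) (hl₂ : 0 < l₂)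
    (σ11 σ12 σ22 : ℝ × ℝ → ℝ)
    (hloc11 : LocallyIntegrable σ11 volume)
    (hloc12 : LocallyIntegrable σ12 volume)
    (hloc22 : LocallyIntegrable σ22 volume)
    (hper : ∀ᵐ p : ℝ × ℝ ∂volume,
      σ11 (p.1 + l₁, p.2) = σ11 p ∧ σ11 (p.1, p.2 + l₂) = σ11 p ∧
      σ12 (p.1 + l₁, p.2) = σ12 p ∧ σ12 (p.1, p.2 + l₂) = σ12 p ∧
      σ22 (p.1 + l₁, p.2) = σ22 p ∧ σ22 (p.1, p.2 + l₂) = σ22 p)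
    (hdiv : ∀ φ₁ φ₂ : ℝ × ℝ → ℝ, ContDiff ℝ (⊤ : ℕ∞) φ₁ → ContDiff ℝ (⊤ : ℕ∞) φ₂ →
      HasCompactSupport φ₁ → HasCompactSupport φ₂ →
      ∫ p : ℝ × ℝ, (σ11 p * pd1 φ₁ p + σ12 p * pd2 φ₁ p
        + σ12 p * pd1 φ₂ p + σ22 p * pd2 φ₂ p) = 0)
    (α : ℝ)
    (hcont : ∃ U : Set (ℝ × ℝ), IsOpen U ∧ (∀ x : ℝ, (x, α) ∈ U) ∧
      ContinuousOn σ11 U ∧ ContinuousOn σ12 U ∧ ContinuousOn σ22 U)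
    (K G : ℝ) (hK : 0 < K) (hG : 0 < G)
    (c : ℝ) (V : Set (ℝ × ℝ)) (hV : IsOpen V)
    (hγ₁V : Icc c (c + l₁) ×ˢ ({α} : Set ℝ) ⊆ V)
    (u : ℝ × ℝ → ℝ × ℝ) (hu : ContDiffOn ℝ 1 u V)
    (hHooke : ∀ p ∈ V,
      σ11 p = (K + G) * eps11 u p + (K - G) * eps22 u p ∧
      σ22 p = (K - G) * eps11 u p + (K + G) * eps22 u p ∧
      σ12 p = 2 * G * eps12 u p)
    (ξ11 : ℝ)
    (hξ : (u (c + l₁, α)).1 - (u (c, α)).1 = ξ11 * l₁) :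
    ξ11 = (1 / (4 * K)) * ((1 / l₁) * (∫ x in c..(c + l₁), σ11 (x, α))
            + (1 / (l₁ * l₂)) * ∫ p in Ioo (0:ℝ) l₁ ×ˢ Ioo (0:ℝ) l₂, σ22 p)
        + (1 / (4 * G)) * ((1 / l₁) * (∫ x in c..(c + l₁), σ11 (x, α))
            - (1 / (l₁ * l₂)) * ∫ p in Ioo (0:ℝ) l₁ ×ˢ Ioo (0:ℝ) l₂, σ22 p) := by
  obtain ⟨U, hU, hm, c11, c12, c22⟩ := hcont
  have hdiv' : ∀ φ : ℝ × ℝ → ℝ, ContDiff ℝ (⊤ : ℕ∞) φ → HasCompactSupport φ →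
      ∫ p : ℝ × ℝ, (σ12 p * pd1 φ p + σ22 p * pd2 φ p) = 0 := by
    intro φ h1 h2
    have := hdiv (fun _ => 0) φ contDiff_const h1 HasCompactSupport.zero h2
    simpa [pd1, pd2] using this
  have hY : ∀ δ > 0, ∫ p, σ22 p *
      (indicator (Ico c (c + l₁)) (fun _ => (1:ℝ)) p.1 * kap α δ p.2) =
      (1 / l₂) * ∫ p in Ioo (0:ℝ) l₁ ×ˢ Ioo (0:ℝ) l₂, σ22 p := by
    intro δ hδ
    have := cell_id hl₁ hl₂ hloc12 hloc22 (hper.mono fun p hp => by simpa [Prod.add_def] using hp.2.2.1)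
      (hper.mono fun p hp => by simpa [Prod.add_def] using hp.2.2.2.2.1)
      (hper.mono fun p hp => by simpa [Prod.add_def] using hp.2.2.2.2.2) hdiv' α c δ hδ
    rw [← this]
    field_simp
  have hline := line_id hl₁ hloc22 α c hU hm c22 _ hY
  have k11 : Continuous (fun x => σ11 (x, α)) := c11.comp_continuous (by fun_prop) hm
  have k22 : Continuous (fun x => σ22 (x, α)) := c22.comp_continuous (by fun_prop) hm
  have hf := ftc_id hl₁ hV hγ₁V hu
    (g := fun x => (1 / 4 * (1 / K + 1 / G)) * σ11 (x, α) + (1 / 4 * (1 / K - 1 / G)) * σ22 (x, α))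
    ((k11.const_mul _).add (k22.const_mul _)) (fun x hx => by
      obtain ⟨h1, h2, -⟩ := hHooke (x, α) (hγ₁V ⟨hx, rfl⟩)
      beta_reduce
      rw [h1, h2]
      field_simp
      ring)
  rw [hξ, intervalIntegral.integral_add ((k11.const_mul _).intervalIntegrable _ _)
    ((k22.const_mul _).intervalIntegrable _ _), intervalIntegral.integral_const_mul,
    intervalIntegral.integral_const_mul, hline] at hf
  rw [eq_div_of_mul_eq hl₁.ne' hf]
  field_simp
  ring
end

section
/- Let σ be a Y-periodic stress field on ℝ², divergence-free in the sense of distributions, continuous on an open neighborhood of the vertical line {β} × ℝ for some β ∈ ℝ. Suppose there are c ∈ ℝ, an open set V ⊆ ℝ² containing the segment γ₂ = {β} × [c, c+l₂], a C¹ map u : V → ℝ² whose strain ε(u) satisfies Hooke's law with moduli K, G > 0 relative to σ on V, and a real number ξ₂₂ with u₂(β, c+l₂) − u₂(β, c) = ξ₂₂ l₂. Then ξ₂₂ = (1/(4K))( ⨍_{γ₂} σ₂₂ + ⨍_Y σ₁₁ ) + (1/(4G))( ⨍_{γ₂} σ₂₂ − ⨍_Y σ₁₁ ), where ⨍_{γ₂}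 σ₂₂ = (1/l₂)∫_c^{c+l₂} σ₂₂(β, y) dy and ⨍_Y σ₁₁ = (1/(l₁l₂))∫_Y σ₁₁ dx. -/
open MeasureTheory Set

lemma aux_prim (g : ℝ → ℝ) (hg : ContDiff ℝ (⊤ : ℕ∞) g) (hc : HasCompactSupport g)
    (h0 : ∫ x, g x = 0) :
    ContDiff ℝ (⊤ : ℕ∞) (fun x => ∫ t in Iic x, g t) ∧
    HasCompactSupport (fun x => ∫ t in Iic x, g t) ∧
    ∀ x, HasDerivAt (fun x => ∫ t in Iic x, g t) (g x) x := by
  have hcont := hg.continuous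
  have hint : Integrable g := hcont.integrable_of_hasCompactSupport hc
  have hd : ∀ x, HasDerivAt (fun x => ∫ t in Iic x, g t) (g x) x := by
    intro x
    have h1 : HasDerivAt (fun u => ∫ t in (0:ℝ)..u, g t) (g x) x :=
      intervalIntegral.integral_hasDerivAt_right (hcont.intervalIntegrable _ _)
        hcont.aestronglyMeasurable.stronglyMeasurableAtFilter hcont.continuousAt
    have h2 := h1.const_add (∫ t in Iic (0:ℝ), g t)
    refine h2.congr_of_eventuallyEq (Filter.Eventually.of_forall fun y => ?_)
    have := intervalIntegral.integral_Iic_sub_Iic (a := 0) (b := y) hint.integrableOn hint.integrableOn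
    simp only
    linarith
  refine ⟨?_, ?_, hd⟩
  · rw [contDiff_infty_iff_deriv]
    refine ⟨fun x => (hd x).differentiableAt, ?_⟩
    have : deriv (fun x => ∫ t in Iic x, g t) = g := funext fun x => (hd x).deriv
    rw [this]; exact hg
  · obtain ⟨R, hR, hz⟩ := hc.exists_pos_le_norm
    refine HasCompactSupport.intro (isCompact_Icc (a := -R) (b := R)) fun x hx => ?_
    have hx' : x < -R ∨ R < x := by
      by_contra h
      push Not at h
      exact hx ⟨h.1, h.2⟩
    rcases hx' with h | h
    · refine setIntegral_eq_zero_of_forall_eq_zero fun t ht => hz t ?_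
      rw [Real.norm_eq_abs, le_abs]
      right; have : t ≤ x := ht; linarith
    · rw [setIntegral_eq_integral_of_forall_compl_eq_zero, h0]
      intro t ht
      refine hz t ?_
      rw [Real.norm_eq_abs, le_abs]
      left; have : x < t := by simpa using ht
      linarith

lemma aux_shift_s4 (M : ℝ → ℝ) (hM : LocallyIntegrable M volume) (l : ℝ)
    (hp : ∀ᵐ y, M (y + l) = M y) (a b : ℝ) :
    ∫ y in a..(a + l), M y = ∫ y in b..(b + l), M y := by
  have hi : ∀ p q, IntervalIntegrable M volume p q := fun p q =>
    (hM.integrableOn_isCompact isCompact_uIcc).intervalIntegrable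
  have h1 : ∫ y in a..b, M y = ∫ y in (a + l)..(b + l), M y := by
    rw [← intervalIntegral.integral_comp_add_right]
    exact intervalIntegral.integral_congr_ae (hp.mono fun y hy _ => hy.symm)
  have h2 := intervalIntegral.integral_add_adjacent_intervals (hi a b) (hi b (b + l))
  have h3 := intervalIntegral.integral_add_adjacent_intervals (hi a (a + l)) (hi (a + l) (b + l))
  linarith

lemma aux_unfold (M : ℝ → ℝ) (hM : LocallyIntegrable M volume) (l : ℝ) (hl : 0 < l)
    (hp : ∀ᵐ y, M (y + l) = M y) (ρ : ℝ → ℝ) (hρ : Continuous ρ) (hc : HasCompactSupport ρ)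
    (h1 : ∫ x, ρ x = 1) (c : ℝ) :
    ∫ y, M y * (∫ t in (y - l)..y, ρ t) = ∫ y in c..(c + l), M y := by
  obtain ⟨R, hR, hz⟩ := hc.exists_pos_le_norm
  let S : Set (ℝ × ℝ) := {p | p.2 < p.1 ∧ p.1 ≤ p.2 + l}
  have hS : MeasurableSet S :=
    (measurableSet_lt measurable_snd measurable_fst).inter
      (measurableSet_le measurable_fst (measurable_snd.add_const l))
  let F : ℝ → ℝ → ℝ := fun y t => S.indicator (fun p => M p.1 * ρ p.2) (y, t)
  have hF : Integrable (Function.uncurry F) (volume.prod volume) := by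
    have hM' : Integrable ((Icc (-R) (R + l)).indicator M) :=
      (hM.integrableOn_isCompact isCompact_Icc).integrable_indicator measurableSet_Icc
    have hρi : Integrable ρ volume := hρ.integrable_of_hasCompactSupport hc
    have := (hM'.mul_prod hρi).indicator hS
    refine this.congr (Filter.Eventually.of_forall fun p => ?_)
    obtain ⟨y, t⟩ := p
    simp only [Function.uncurry, F, Set.indicator_apply]
    by_cases h : (y, t) ∈ S
    · simp only [h, if_true]
      by_cases hy : y ∈ Icc (-R) (R + l)
      · simp [hy]
      · have : ρ t = 0 := by
          apply hz
          rw [Real.norm_eq_abs, le_abs]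
          by_contra hh
          push Not at hh
          have h' : t < y ∧ y ≤ t + l := h
          exact hy ⟨by linarith, by linarith⟩
        simp [this]
    · simp [h]
  have hL : ∀ y, M y * (∫ t in (y - l)..y, ρ t) = ∫ t, F y t := by
    intro y
    rw [intervalIntegral.integral_of_le (by linarith), ← integral_Ico_eq_integral_Ioc,
      ← integral_const_mul, ← integral_indicator measurableSet_Ico]
    congr 1; ext t
    have : ((y, t) ∈ S) ↔ t ∈ Ico (y - l) y := by
      simp only [S, mem_ofPred_eq, mem_Ico]
      constructor
      · rintro ⟨a, b⟩; exact ⟨by linarith, a⟩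
      · rintro ⟨a, b⟩; exact ⟨b, by linarith⟩
    simp only [F, Set.indicator_apply, this]
  have hRr : ∀ t, ∫ y, F y t = ρ t * ∫ y in c..(c + l), M y := by
    intro t
    rw [aux_shift_s4 M hM l hp c t, intervalIntegral.integral_of_le (by linarith),
      ← integral_const_mul, ← integral_indicator measurableSet_Ioc]
    congr 1; ext y
    have : ((y, t) ∈ S) ↔ y ∈ Ioc t (t + l) := by
      simp only [S, mem_ofPred_eq, mem_Ioc]
    simp only [F, Set.indicator_apply, this, mul_comm]
  simp_rw [hL]
  rw [integral_integral_swap hF]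
  simp_rw [hRr]
  rw [integral_mul_const, h1, one_mul]

lemma aux_const_s4 (H : ℝ → ℝ) (hH : LocallyIntegrable H volume)
    (h0 : ∀ f : ℝ → ℝ, ContDiff ℝ (⊤ : ℕ∞) f → HasCompactSupport f → ∫ x, H x * deriv f x = 0)
    (β : ℝ) (hβ : ContinuousAt H β) : ∀ᵐ x, H x = H β := by
  let φ : ℕ → ContDiffBump (0 : ℝ) := fun n =>
    ⟨1 / ((n : ℝ) + 1), 2 / ((n : ℝ) + 1), by positivity, by gcongr; norm_num⟩
  have hφ : Filter.Tendsto (fun i => (φ i).rOut) Filter.atTop (nhds 0) := by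
    have := (tendsto_one_div_add_atTop_nhds_zero_nat (𝕜 := ℝ)).const_mul 2
    simpa [φ, div_eq_mul_inv] using this
  have hφ' : ∀ᶠ i in Filter.atTop, (φ i).rOut ≤ 2 * (φ i).rIn := by
    refine Filter.Eventually.of_forall fun i => ?_
    simp [φ, div_eq_mul_inv]
  have hb := ContDiffBump.convolution_tendsto_right (μ := volume) (g := fun _ => H) (k := fun _ => β)
    (z₀ := H β) hφ
    (Filter.Eventually.of_forall fun _ => hH.aestronglyMeasurable)
    (hβ.tendsto.comp Filter.tendsto_snd) tendsto_const_nhds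
  filter_upwards [ContDiffBump.ae_convolution_tendsto_right_of_locallyIntegrable hφ hφ' hH] with x hx
  refine tendsto_nhds_unique hx (hb.congr fun i => ?_)
  set η := (φ i).normed volume with hη
  have hηs : ContDiff ℝ (⊤ : ℕ∞) η := (φ i).contDiff_normed
  have hηc : HasCompactSupport η := (φ i).hasCompactSupport_normed
  have hsm : ∀ z, ContDiff ℝ (⊤ : ℕ∞) (fun t => η (z - t)) := fun z =>
    hηs.comp (contDiff_const.sub contDiff_id)
  have hcs : ∀ z, HasCompactSupport (fun t => η (z - t)) := fun z =>
    hηc.comp_homeomorph (Homeomorph.subLeft z)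
  have hint : ∀ z, Integrable (fun t => η (z - t)) := fun z =>
    (hsm z).continuous.integrable_of_hasCompactSupport (hcs z)
  have hHint : ∀ z, Integrable (fun t => H t * η (z - t)) := fun z =>
    hH.integrable_smul_right_of_hasCompactSupport (hsm z).continuous (hcs z)
  obtain ⟨h1, h2, h3⟩ := aux_prim (fun t => η (β - t) - η (x - t)) ((hsm β).sub (hsm x))
    ((hcs β).sub (hcs x))
    (by rw [integral_sub (hint β) (hint x), integral_sub_left_eq_self, integral_sub_left_eq_self, sub_self])
  have h4 := h0 _ h1 h2
  simp_rw [fun x => (h3 x).deriv, mul_sub] at h4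
  rw [integral_sub (hHint β) (hHint x), sub_eq_zero] at h4
  simp only [convolution_eq_swap, ContinuousLinearMap.lsmul_apply, smul_eq_mul]
  simpa [mul_comm] using h4

lemma aux_swap {P : ℝ × ℝ → Prop} (h : ∀ᵐ p : ℝ × ℝ ∂volume, P p) :
    ∀ᵐ y : ℝ, ∀ᵐ x : ℝ, P (x, y) := by
  have h' : ∀ᵐ p : ℝ × ℝ ∂(volume.prod volume), P p.swap :=
    (Measure.measurePreserving_swap (μ := (volume : Measure ℝ))
      (ν := (volume : Measure ℝ))).quasiMeasurePreserving.ae h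
  exact Measure.ae_ae_of_ae_prod h'

lemma aux_int_s4 (σ : ℝ × ℝ → ℝ) (hσ : LocallyIntegrable σ volume) (g : ℝ → ℝ) (hg : Continuous g)
    (hc : HasCompactSupport g) (K : Set ℝ) (hK : IsCompact K) :
    Integrable (fun p : ℝ × ℝ => σ p * g p.1) (volume.prod (volume.restrict K)) := by
  have h1 : IntegrableOn (fun p : ℝ × ℝ => σ p * g p.1) (tsupport g ×ˢ K) volume :=
    (hσ.integrableOn_isCompact (hc.isCompact.prod hK)).mul_continuousOn
      (hg.comp continuous_fst).continuousOn (hc.isCompact.prod hK)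
  have h2 : IntegrableOn (fun p : ℝ × ℝ => σ p * g p.1) (univ ×ˢ K) volume := by
    refine h1.of_forall_sdiff_eq_zero (MeasurableSet.univ.prod hK.measurableSet) ?_
    rintro ⟨x, y⟩ ⟨hx, hx'⟩
    have : x ∉ tsupport g := fun h => hx' ⟨h, hx.2⟩
    simp [image_eq_zero_of_notMem_tsupport this]
  have h3 := Measure.prod_restrict (μ := (volume : Measure ℝ)) (ν := (volume : Measure ℝ)) univ K
  rw [Measure.restrict_univ] at h3
  rw [h3]; exact h2

lemma aux_pd_s4 (f χ f' χ' : ℝ → ℝ) (hf : ∀ x, HasDerivAt f (f' x) x) (hχ : ∀ x, HasDerivAt χ (χ' x) x)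
    (p : ℝ × ℝ) :
    pd1 (fun q => f q.1 * χ q.2) p = f' p.1 * χ p.2 ∧
    pd2 (fun q => f q.1 * χ q.2) p = f p.1 * χ' p.2 := by
  have h1 : HasFDerivAt (fun q : ℝ × ℝ => f q.1) _ p := (hf p.1).hasFDerivAt.comp p hasFDerivAt_fst
  have h2 : HasFDerivAt (fun q : ℝ × ℝ => χ q.2) _ p := (hχ p.2).hasFDerivAt.comp p hasFDerivAt_snd
  have h3 := (h1.mul h2).fderiv
  have h4 : fderiv ℝ (fun q : ℝ × ℝ => f q.1 * χ q.2) p = _ := h3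
  unfold pd1 pd2
  rw [h4]
  constructor <;> simp [mul_comm]

lemma aux_H (l₂ : ℝ) (hl₂ : 0 < l₂)
    (σ11 σ12 σ22 : ℝ × ℝ → ℝ)
    (hloc11 : LocallyIntegrable σ11 volume)
    (hloc12 : LocallyIntegrable σ12 volume)
    (hper11 : ∀ᵐ p : ℝ × ℝ ∂volume, σ11 (p.1, p.2 + l₂) = σ11 p)
    (hper12 : ∀ᵐ p : ℝ × ℝ ∂volume, σ12 (p.1, p.2 + l₂) = σ12 p)
    (hdiv : ∀ φ₁ φ₂ : ℝ × ℝ → ℝ, ContDiff ℝ (⊤ : ℕ∞) φ₁ → ContDiff ℝ (⊤ : ℕ∞) φ₂ →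
      HasCompactSupport φ₁ → HasCompactSupport φ₂ →
      ∫ p : ℝ × ℝ, (σ11 p * pd1 φ₁ p + σ12 p * pd2 φ₁ p
        + σ12 p * pd1 φ₂ p + σ22 p * pd2 φ₂ p) = 0)
    (c : ℝ) (f : ℝ → ℝ) (hf : ContDiff ℝ (⊤ : ℕ∞) f) (hfc : HasCompactSupport f) :
    ∫ x, (∫ y in c..(c + l₂), σ11 (x, y)) * deriv f x = 0 := by
  -- the bump
  let b : ContDiffBump (0 : ℝ) := ⟨1, 2, by norm_num, by norm_num⟩
  obtain ⟨ρ, hρs, hρc, hρ1⟩ : ∃ ρ : ℝ → ℝ, ContDiff ℝ (⊤ : ℕ∞) ρ ∧ HasCompactSupport ρ ∧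
      ∫ x, ρ x = 1 :=
    ⟨b.normed volume, b.contDiff_normed, b.hasCompactSupport_normed, b.integral_normed⟩
  have hρi : Integrable ρ := hρs.continuous.integrable_of_hasCompactSupport hρc
  have hτs : ContDiff ℝ (⊤ : ℕ∞) (fun t => ρ (t - l₂)) := hρs.comp (contDiff_id.sub contDiff_const)
  have hτc : HasCompactSupport (fun t => ρ (t - l₂)) :=
    hρc.comp_homeomorph (Homeomorph.subRight l₂)
  have hτi : Integrable (fun t => ρ (t - l₂)) := hρi.comp_sub_right l₂
  obtain ⟨hχs, hχc, hχd⟩ := aux_prim (fun t => ρ t - ρ (t - l₂)) (hρs.sub hτs) (hρc.sub hτc)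
    (by rw [integral_sub hρi hτi, integral_sub_right_eq_self, sub_self])
  have hχe : ∀ y, ∫ t in Iic y, (ρ t - ρ (t - l₂)) = ∫ t in (y - l₂)..y, ρ t := by
    intro y
    rw [integral_sub hρi.integrableOn hτi.integrableOn,
      ← intervalIntegral.integral_Iic_sub_Iic hρi.integrableOn hρi.integrableOn]
    congr 1
    have := (measurePreserving_sub_right (volume : Measure ℝ) l₂).setIntegral_preimage_emb
      (Homeomorph.subRight l₂).measurableEmbedding ρ (Iic (y - l₂))
    rw [← this]
    congr 2
    ext t; simp
  simp_rw [hχe] at hχs hχc hχd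
  set χ : ℝ → ℝ := fun y => ∫ t in (y - l₂)..y, ρ t with hχ
  have hfd : ∀ x, HasDerivAt f (deriv f x) x := fun x =>
    ((hf.differentiable (by simp)) x).hasDerivAt
  have hf's : Continuous (deriv f) := hf.continuous_deriv (by exact_mod_cast le_top)
  have hf'c : HasCompactSupport (deriv f) := hfc.deriv
  -- compact support of products
  have hcsp : ∀ (g h : ℝ → ℝ), HasCompactSupport g → HasCompactSupport h →
      HasCompactSupport (fun q : ℝ × ℝ => g q.1 * h q.2) := by
    intro g h hg hh
    refine HasCompactSupport.intro (hg.isCompact.prod hh.isCompact) ?_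
    rintro ⟨x, y⟩ hxy
    simp only [mem_prod, not_and_or] at hxy
    rcases hxy with h | h <;> simp [image_eq_zero_of_notMem_tsupport h]
  have hI : ∀ (σ : ℝ × ℝ → ℝ) (g h : ℝ → ℝ), LocallyIntegrable σ volume → Continuous g →
      Continuous h → HasCompactSupport g → HasCompactSupport h →
      Integrable (fun q : ℝ × ℝ => σ q * (g q.1 * h q.2)) volume := by
    intro σ g h hσ hg hh hgc hhc
    exact hσ.integrable_smul_right_of_hasCompactSupport
      ((hg.comp continuous_fst).mul (hh.comp continuous_snd)) (hcsp g h hgc hhc)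
  have hD := hdiv (fun q => f q.1 * χ q.2) (fun _ => 0)
    ((hf.comp contDiff_fst).mul (hχs.comp contDiff_snd)) contDiff_const
    (hcsp f χ hfc hχc) HasCompactSupport.zero
  have hz1 : ∀ p : ℝ × ℝ, pd1 (fun _ => (0:ℝ)) p = 0 := fun p => by simp [pd1]
  have hz2 : ∀ p : ℝ × ℝ, pd2 (fun _ => (0:ℝ)) p = 0 := fun p => by simp [pd2]
  simp_rw [fun p => (aux_pd_s4 f χ _ _ hfd hχd p).1, fun p => (aux_pd_s4 f χ _ _ hfd hχd p).2,
    hz1, hz2, mul_zero, add_zero] at hD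
  rw [integral_add (hI σ11 _ _ hloc11 hf's hχs.continuous hf'c hχc)
    (hI σ12 f (fun t => ρ t - ρ (t - l₂)) hloc12 hf.continuous (hρs.sub hτs).continuous hfc
      (hρc.sub hτc))] at hD
  have hP : ∫ p : ℝ × ℝ, σ12 p * (f p.1 * (ρ p.2 - ρ (p.2 - l₂))) = 0 := by
    simp_rw [mul_sub]
    rw [integral_sub (hI σ12 f ρ hloc12 hf.continuous hρs.continuous hfc hρc)
      (hI σ12 f (fun t => ρ (t - l₂)) hloc12 hf.continuous hτs.continuous hfc hτc), sub_eq_zero]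
    rw [← integral_add_right_eq_self
      (fun p : ℝ × ℝ => σ12 p * (f p.1 * ρ (p.2 - l₂))) ((0, l₂) : ℝ × ℝ)]
    refine integral_congr_ae (hper12.mono fun p hp => ?_)
    have : p + (0, l₂) = (p.1, p.2 + l₂) := by ext <;> simp
    simp only [this, hp, add_sub_cancel_right]
  rw [hP, add_zero] at hD
  let N : ℝ → ℝ := fun y => ∫ x, σ11 (x, y) * deriv f x
  have hN : LocallyIntegrable N volume := by
    rw [locallyIntegrable_iff]
    intro k hk
    exact (aux_int_s4 σ11 hloc11 _ hf's hf'c k hk).integral_prod_right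
  have hNp : ∀ᵐ y, N (y + l₂) = N y := by
    filter_upwards [aux_swap hper11] with y hy
    refine integral_congr_ae (hy.mono fun x hx => ?_)
    simp only [hx]
  have hND : ∫ y, N y * χ y = 0 := by
    rw [← hD]
    have hii := hI σ11 _ _ hloc11 hf's hχs.continuous hf'c hχc
    rw [Measure.volume_eq_prod] at hii ⊢
    rw [integral_prod_symm _ hii]
    refine integral_congr_ae (Filter.Eventually.of_forall fun y => ?_)
    simp only [N]
    rw [← integral_mul_const]
    simp only [mul_assoc]
  rw [aux_unfold N hN l₂ hl₂ hNp ρ hρs.continuous hρc hρ1 c] at hND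
  rw [← hND, intervalIntegral.integral_of_le (by linarith)]
  have hii : Integrable (fun p : ℝ × ℝ => σ11 p * deriv f p.1)
      (volume.prod (volume.restrict (Ioc c (c + l₂)))) :=
    (aux_int_s4 σ11 hloc11 _ hf's hf'c (Icc c (c + l₂)) isCompact_Icc).mono_measure
      (Measure.prod_mono le_rfl (Measure.restrict_mono Ioc_subset_Icc_self le_rfl))
  have := integral_integral_swap (f := fun x y => σ11 (x, y) * deriv f x) hii
  rw [← this]
  refine integral_congr_ae (Filter.Eventually.of_forall fun x => ?_)
  simp only
  rw [intervalIntegral.integral_of_le (by linarith), integral_mul_const]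

lemma aux_contAt_s4 (σ : ℝ × ℝ → ℝ) (U : Set (ℝ × ℝ)) (hU : IsOpen U) (β : ℝ)
    (hβ : ∀ y : ℝ, (β, y) ∈ U) (hσ : ContinuousOn σ U) (a b : ℝ) :
    ContinuousAt (fun x => ∫ y in a..b, σ (x, y)) β := by
  obtain ⟨A, B, hA, hB, hsA, hsB, hAB⟩ := generalized_tube_lemma (isCompact_singleton (x := β))
    (isCompact_uIcc (a := a) (b := b)) hU (by rintro ⟨x, y⟩ ⟨hx, -⟩; rw [mem_singleton_iff] at hx
                                              simp only at hx; subst hx; exact hβ y)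
  obtain ⟨r, hr, hrA⟩ := Metric.nhds_basis_closedBall.mem_iff.1 (hA.mem_nhds (hsA rfl))
  have hsub : Metric.closedBall β r ×ˢ uIcc a b ⊆ U :=
    (prod_mono hrA hsB).trans hAB
  obtain ⟨C, hC⟩ := ((isCompact_closedBall β r).prod isCompact_uIcc).exists_bound_of_continuousOn
    (hσ.mono hsub)
  have hball := Metric.closedBall_mem_nhds β hr
  refine intervalIntegral.continuousAt_of_dominated_interval (bound := fun _ => C) ?_ ?_ ?_ ?_
  · filter_upwards [hball] with x hx
    refine ContinuousOn.aestronglyMeasurable ?_ measurableSet_uIoc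
    refine (hσ.mono hsub).comp (by fun_prop) ?_
    intro y hy
    exact ⟨hx, uIoc_subset_uIcc hy⟩
  · filter_upwards [hball] with x hx
    exact Filter.Eventually.of_forall fun y hy => hC _ ⟨hx, uIoc_subset_uIcc hy⟩
  · exact intervalIntegrable_const
  · refine Filter.Eventually.of_forall fun y _ => ?_
    exact ContinuousAt.comp (f := fun x => (x, y)) (hσ.continuousAt (hU.mem_nhds (hβ y)))
      (by fun_prop)

lemma aux_avg (l₁ l₂ : ℝ) (hl₁ : 0 < l₁) (hl₂ : 0 < l₂)
    (σ11 σ12 σ22 : ℝ × ℝ → ℝ)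
    (hloc11 : LocallyIntegrable σ11 volume)
    (hloc12 : LocallyIntegrable σ12 volume)
    (hper11 : ∀ᵐ p : ℝ × ℝ ∂volume, σ11 (p.1, p.2 + l₂) = σ11 p)
    (hper12 : ∀ᵐ p : ℝ × ℝ ∂volume, σ12 (p.1, p.2 + l₂) = σ12 p)
    (hdiv : ∀ φ₁ φ₂ : ℝ × ℝ → ℝ, ContDiff ℝ (⊤ : ℕ∞) φ₁ → ContDiff ℝ (⊤ : ℕ∞) φ₂ →
      HasCompactSupport φ₁ → HasCompactSupport φ₂ →
      ∫ p : ℝ × ℝ, (σ11 p * pd1 φ₁ p + σ12 p * pd2 φ₁ p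
        + σ12 p * pd1 φ₂ p + σ22 p * pd2 φ₂ p) = 0)
    (β c : ℝ) (U : Set (ℝ × ℝ)) (hU : IsOpen U)
    (hβ : ∀ y : ℝ, (β, y) ∈ U) (hσ : ContinuousOn σ11 U) :
    ∫ p in Ioo (0:ℝ) l₁ ×ˢ Ioo (0:ℝ) l₂, σ11 p = l₁ * ∫ y in c..(c + l₂), σ11 (β, y) := by
  have hio : ∀ a b a' b' : ℝ, IntegrableOn σ11 (Ioc a b ×ˢ Ioc a' b') (volume.prod volume) :=
    fun a b a' b' => (hloc11.integrableOn_isCompact (isCompact_Icc.prod isCompact_Icc)).mono_set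
      (prod_mono Ioc_subset_Icc_self Ioc_subset_Icc_self)
  have hHl : LocallyIntegrable (fun x => ∫ y in c..(c + l₂), σ11 (x, y)) volume := by
    rw [locallyIntegrable_iff]
    intro k hk
    have h1 : IntegrableOn σ11 (k ×ˢ Ioc c (c + l₂)) (volume.prod volume) :=
      (hloc11.integrableOn_isCompact (hk.prod isCompact_Icc)).mono_set
        (prod_mono le_rfl Ioc_subset_Icc_self)
    rw [IntegrableOn, ← Measure.prod_restrict] at h1
    have := h1.integral_prod_left
    simp_rw [intervalIntegral.integral_of_le (show c ≤ c + l₂ by linarith)]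
    exact this
  have hH := aux_const_s4 _ hHl
    (aux_H l₂ hl₂ σ11 σ12 σ22 hloc11 hloc12 hper11 hper12 hdiv c) β
    (aux_contAt_s4 σ11 U hU β hβ hσ _ _)
  let M : ℝ → ℝ := fun y => ∫ x in Ioc 0 l₁, σ11 (x, y)
  have hM : LocallyIntegrable M volume := by
    rw [locallyIntegrable_iff]
    intro k hk
    have h1 : IntegrableOn σ11 (Ioc 0 l₁ ×ˢ k) (volume.prod volume) :=
      (hloc11.integrableOn_isCompact (isCompact_Icc.prod hk)).mono_set
        (prod_mono Ioc_subset_Icc_self le_rfl)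
    rw [IntegrableOn, ← Measure.prod_restrict] at h1
    exact h1.integral_prod_right
  have hMp : ∀ᵐ y, M (y + l₂) = M y := by
    filter_upwards [aux_swap hper11] with y hy
    exact integral_congr_ae (ae_restrict_of_ae (hy.mono fun x hx => hx))
  have hMs : ∀ a, ∫ p in Ioc (0:ℝ) l₁ ×ˢ Ioc a (a + l₂), σ11 p = ∫ y in a..(a + l₂), M y := by
    intro a
    have h1 := hio 0 l₁ a (a + l₂)
    rw [IntegrableOn, ← Measure.prod_restrict] at h1
    rw [Measure.volume_eq_prod, ← Measure.prod_restrict, integral_prod_symm _ h1,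
      intervalIntegral.integral_of_le (by linarith)]
  have hae : (Ioo (0:ℝ) l₁ ×ˢ Ioo (0:ℝ) l₂ : Set (ℝ × ℝ)) =ᵐ[volume] Ioc (0:ℝ) l₁ ×ˢ Ioc (0:ℝ) l₂ :=
    Measure.set_prod_ae_eq Ioo_ae_eq_Ioc Ioo_ae_eq_Ioc
  rw [setIntegral_congr_set hae]
  have e0 := hMs 0
  rw [zero_add] at e0
  have e1 := aux_shift_s4 M hM l₂ hMp 0 c
  rw [zero_add] at e1
  rw [e0, e1, ← hMs c, Measure.volume_eq_prod, setIntegral_prod _ (hio _ _ _ _)]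
  simp_rw [← intervalIntegral.integral_of_le (show c ≤ c + l₂ by linarith)]
  rw [integral_congr_ae (ae_restrict_of_ae hH)]
  simp [hl₁.le]

/-- Representation of the quasiperiod `ξ₂₂` in terms of the line average of `σ₂₂` over the
vertical segment `γ₂` and the cell average of `σ₁₁`. -/
theorem quasiperiod_xi22_representation
    (l₁ l₂ : ℝ) (hl₁ : 0 < l₁) (hl₂ : 0 < l₂)
    (σ11 σ12 σ22 : ℝ × ℝ → ℝ)
    (hloc11 : LocallyIntegrable σ11 volume)
    (hloc12 : LocallyIntegrable σ12 volume)
    (hloc22 : LocallyIntegrable σ22 volume)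
    (hper : ∀ᵐ p : ℝ × ℝ ∂volume,
      σ11 (p.1 + l₁, p.2) = σ11 p ∧ σ11 (p.1, p.2 + l₂) = σ11 p ∧
      σ12 (p.1 + l₁, p.2) = σ12 p ∧ σ12 (p.1, p.2 + l₂) = σ12 p ∧
      σ22 (p.1 + l₁, p.2) = σ22 p ∧ σ22 (p.1, p.2 + l₂) = σ22 p)
    (hdiv : ∀ φ₁ φ₂ : ℝ × ℝ → ℝ, ContDiff ℝ (⊤ : ℕ∞) φ₁ → ContDiff ℝ (⊤ : ℕ∞) φ₂ →
      HasCompactSupport φ₁ → HasCompactSupport φ₂ →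
      ∫ p : ℝ × ℝ, (σ11 p * pd1 φ₁ p + σ12 p * pd2 φ₁ p
        + σ12 p * pd1 φ₂ p + σ22 p * pd2 φ₂ p) = 0)
    (β : ℝ)
    (hcont : ∃ U : Set (ℝ × ℝ), IsOpen U ∧ (∀ y : ℝ, (β, y) ∈ U) ∧
      ContinuousOn σ11 U ∧ ContinuousOn σ12 U ∧ ContinuousOn σ22 U)
    (K G : ℝ) (hK : 0 < K) (hG : 0 < G)
    (c : ℝ) (V : Set (ℝ × ℝ)) (hV : IsOpen V)
    (hγ₂V : ({β} : Set ℝ) ×ˢ Icc c (c + l₂) ⊆ V)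
    (u : ℝ × ℝ → ℝ × ℝ) (hu : ContDiffOn ℝ 1 u V)
    (hHooke : ∀ p ∈ V,
      σ11 p = (K + G) * eps11 u p + (K - G) * eps22 u p ∧
      σ22 p = (K - G) * eps11 u p + (K + G) * eps22 u p ∧
      σ12 p = 2 * G * eps12 u p)
    (ξ22 : ℝ)
    (hξ : (u (β, c + l₂)).2 - (u (β, c)).2 = ξ22 * l₂) :
    ξ22 = (1 / (4 * K)) * ((1 / l₂) * (∫ y in c..(c + l₂), σ22 (β, y))
            + (1 / (l₁ * l₂)) * ∫ p in Ioo (0:ℝ) l₁ ×ˢ Ioo (0:ℝ) l₂, σ11 p)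
        + (1 / (4 * G)) * ((1 / l₂) * (∫ y in c..(c + l₂), σ22 (β, y))
            - (1 / (l₁ * l₂)) * ∫ p in Ioo (0:ℝ) l₁ ×ˢ Ioo (0:ℝ) l₂, σ11 p) := by
  obtain ⟨U, hU, hβU, hc11, hc12, hc22⟩ := hcont
  have havg := aux_avg l₁ l₂ hl₁ hl₂ σ11 σ12 σ22 hloc11 hloc12 (hper.mono fun p h => h.2.1)
    (hper.mono fun p h => h.2.2.2.1) hdiv β c U hU hβU hc11
  have hline : ∀ σ : ℝ × ℝ → ℝ, ContinuousOn σ U → Continuous fun y => σ (β, y) := by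
    intro σ hσ
    exact hσ.comp_continuous (by fun_prop) hβU
  have hi11 := (hline _ hc11).intervalIntegrable (μ := volume) c (c + l₂)
  have hi22 := (hline _ hc22).intervalIntegrable (μ := volume) c (c + l₂)
  have hFTC := intervalIntegral.integral_eq_sub_of_hasDerivAt (a := c) (b := c + l₂)
    (f := fun y => (u (β, y)).2)
    (f' := fun y => (1 / 4 * (1 / K - 1 / G)) * σ11 (β, y) + (1 / 4 * (1 / K + 1 / G)) * σ22 (β, y))
    (by
      intro y hy
      rw [uIcc_of_le (by linarith)] at hy
      have hmem : (β, y) ∈ V := hγ₂V ⟨rfl, hy⟩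
      obtain ⟨h1, h2, -⟩ := hHooke _ hmem
      have he : (1 / 4 * (1 / K - 1 / G)) * σ11 (β, y) + (1 / 4 * (1 / K + 1 / G)) * σ22 (β, y)
          = eps22 u (β, y) := by
        rw [h1, h2]; field_simp; ring
      rw [he]
      have hd : DifferentiableAt ℝ u (β, y) :=
        (hu.contDiffAt (hV.mem_nhds hmem)).differentiableAt (by simp)
      have hd2 : HasFDerivAt (fun q => (u q).2) _ (β, y) := hd.snd.hasFDerivAt
      have hline : HasDerivAt (fun t : ℝ => (β, t)) (0, 1) y :=
        (hasDerivAt_const y β).prodMk (hasDerivAt_id y)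
      exact hd2.comp_hasDerivAt y hline)
    ((hi11.const_mul _).add (hi22.const_mul _))
  rw [intervalIntegral.integral_add (hi11.const_mul _) (hi22.const_mul _),
    intervalIntegral.integral_const_mul, intervalIntegral.integral_const_mul] at hFTC
  rw [hξ] at hFTC
  rw [havg]
  have : ξ22 = (ξ22 * l₂) / l₂ := by field_simp
  rw [this, ← hFTC]
  field_simp
  ring
end

section
/- Let σ be a C¹ Y-periodic stress field on ℝ² satisfying ∂₁σ₁₁ + ∂₂σ₁₂ = 0 and ∂₁σ₁₂ + ∂₂σ₂₂ = 0 pointwise on ℝ². Then the functions x ↦ ∫_0^{l₂} σ₁₁(x, y) dy and x ↦ ∫_0^{l₂} σ₁₂(x, y) dy are constant on ℝ, and their constant values are (1/l₁)∫_Y σ₁₁ dx and (1/l₁)∫_Y σ₁₂ dx respectively. -/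
open MeasureTheory Set

theorem aux_line (l₁ l₂ : ℝ) (hl₁ : 0 < l₁) (hl₂ : 0 < l₂) (f g : ℝ × ℝ → ℝ)
    (hf : ContDiff ℝ 1 f) (hg : ContDiff ℝ 1 g)
    (hper : ∀ p : ℝ × ℝ, g (p.1, p.2 + l₂) = g p)
    (heq : ∀ p : ℝ × ℝ, pd1 f p + pd2 g p = 0) (x : ℝ) :
    (∫ y in (0:ℝ)..l₂, f (x, y))
      = (1 / l₁) * ∫ p in Ioo (0:ℝ) l₁ ×ˢ Ioo (0:ℝ) l₂, f p := by
  have hconst : ∀ a : ℝ, (∫ y in (0:ℝ)..l₂, f (a, y)) = ∫ y in (0:ℝ)..l₂, f (x, y) := by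
    intro a
    have hz : (fun p : ℝ × ℝ => fderiv ℝ f p (1, 0) + fderiv ℝ g p (0, 1)) = fun _ => 0 :=
      funext heq
    have h := integral2_divergence_prod_of_hasFDerivAt f g (fderiv ℝ f) (fderiv ℝ g)
      x 0 a l₂ hf.continuous.continuousOn hg.continuous.continuousOn
      (fun p _ => (hf.differentiable one_ne_zero p).hasFDerivAt)
      (fun p _ => (hg.differentiable one_ne_zero p).hasFDerivAt)
      (by rw [hz]; exact integrableOn_zero)
    have h1 : ∀ t : ℝ, g (t, l₂) = g (t, 0) := fun t => by simpa using hper (t, 0)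
    have h2 : ∀ s t : ℝ, fderiv ℝ f (s, t) (1, 0) + fderiv ℝ g (s, t) (0, 1) = 0 :=
      fun s t => heq (s, t)
    simp only [h1, h2, intervalIntegral.integral_zero] at h
    linarith
  have hint : IntegrableOn f (Ioo (0:ℝ) l₁ ×ˢ Ioo (0:ℝ) l₂) (volume.prod volume) :=
    (hf.continuous.continuousOn.integrableOn_compact
      ((isCompact_Icc (a := (0:ℝ)) (b := l₁)).prod
        (isCompact_Icc (a := (0:ℝ)) (b := l₂)))).mono_set
      (prod_mono Ioo_subset_Icc_self Ioo_subset_Icc_self)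
  have hin : ∀ a : ℝ, (∫ y in Ioo (0:ℝ) l₂, f (a, y)) = ∫ y in (0:ℝ)..l₂, f (x, y) := by
    intro a
    rw [← hconst a, intervalIntegral.integral_of_le hl₂.le, integral_Ioc_eq_integral_Ioo]
  rw [Measure.volume_eq_prod, setIntegral_prod _ hint]
  simp only [hin]
  simp [hl₁.le]
  field_simp

/-- For a `C¹` `Y`-periodic stress field in equilibrium, the vertical line integrals of `σ₁₁`
and `σ₁₂` are independent of the horizontal coordinate, with constant values given by the
corresponding cell averages. -/
theorem vertical_line_integrals_constant
    (l₁ l₂ : ℝ) (hl₁ : 0 < l₁) (hl₂ : 0 < l₂)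
    (σ11 σ12 σ22 : ℝ × ℝ → ℝ)
    (hC11 : ContDiff ℝ 1 σ11) (hC12 : ContDiff ℝ 1 σ12) (hC22 : ContDiff ℝ 1 σ22)
    (hper : ∀ p : ℝ × ℝ,
      σ11 (p.1 + l₁, p.2) = σ11 p ∧ σ11 (p.1, p.2 + l₂) = σ11 p ∧
      σ12 (p.1 + l₁, p.2) = σ12 p ∧ σ12 (p.1, p.2 + l₂) = σ12 p ∧
      σ22 (p.1 + l₁, p.2) = σ22 p ∧ σ22 (p.1, p.2 + l₂) = σ22 p)
    (hequil : ∀ p : ℝ × ℝ,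
      pd1 σ11 p + pd2 σ12 p = 0 ∧ pd1 σ12 p + pd2 σ22 p = 0) :
    (∀ x : ℝ, (∫ y in (0:ℝ)..l₂, σ11 (x, y))
      = (1 / l₁) * ∫ p in Ioo (0:ℝ) l₁ ×ˢ Ioo (0:ℝ) l₂, σ11 p) ∧
    (∀ x : ℝ, (∫ y in (0:ℝ)..l₂, σ12 (x, y))
      = (1 / l₁) * ∫ p in Ioo (0:ℝ) l₁ ×ˢ Ioo (0:ℝ) l₂, σ12 p) := by
  exact ⟨aux_line l₁ l₂ hl₁ hl₂ σ11 σ12 hC11 hC12 (fun p => (hper p).2.2.2.1)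
      (fun p => (hequil p).1),
    aux_line l₁ l₂ hl₁ hl₂ σ12 σ22 hC12 hC22 (fun p => (hper p).2.2.2.2.2)
      (fun p => (hequil p).2)⟩
end

section
/- Let K, G > 0, let U ⊆ ℝ² be open, let u : U → ℝ² be C², and let σ be the stress field on U obtained from the strain ε(u) by Hooke's law: σ₁₁ = (K+G)ε₁₁ + (K−G)ε₂₂, σ₂₂ = (K−G)ε₁₁ + (K+G)ε₂₂, σ₁₂ = 2Gε₁₂. If ∂₁σ₁₂ + ∂₂σ₂₂ = 0 on U, then ∂₁ω₂₁(u) = −¼(1/K + 1/G) ∂₂(σ₁₁ + σ₂₂) on U, where ω₂₁(u) = ½(∂₁u₂ − ∂₂u₁). -/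
open Set

/-- Rotation component `ω₂₁` of a displacement field `u`. -/
noncomputable def omega21 (u : ℝ × ℝ → ℝ × ℝ) (p : ℝ × ℝ) : ℝ :=
  (1 / 2) * (pd1 (fun q => (u q).2) p - pd2 (fun q => (u q).1) p)

/-- Stress component `σ₁₁` obtained from the strain of `u` by Hooke's law. -/
noncomputable def hooke11 (K G : ℝ) (u : ℝ × ℝ → ℝ × ℝ) (p : ℝ × ℝ) : ℝ :=
  (K + G) * eps11 u p + (K - G) * eps22 u p

/-- Stress component `σ₂₂` obtained from the strain of `u` by Hooke's law. -/
noncomputable def hooke22 (K G : ℝ) (u : ℝ × ℝ → ℝ × ℝ) (p : ℝ × ℝ) : ℝ :=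
  (K - G) * eps11 u p + (K + G) * eps22 u p

/-- Stress component `σ₁₂` obtained from the strain of `u` by Hooke's law. -/
noncomputable def hooke12 (K G : ℝ) (u : ℝ × ℝ → ℝ × ℝ) (p : ℝ × ℝ) : ℝ :=
  2 * G * eps12 u p

theorem aux_diff (U : Set (ℝ × ℝ)) (hU : IsOpen U) (f : ℝ × ℝ → ℝ)
    (hf : ContDiffOn ℝ 2 f U) (p : ℝ × ℝ) (hp : p ∈ U) :
    DifferentiableAt ℝ (pd1 f) p ∧ DifferentiableAt ℝ (pd2 f) p ∧
      pd1 (pd2 f) p = pd2 (pd1 f) p := by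
  have hc : ContDiffAt ℝ 2 f p := hf.contDiffAt (hU.mem_nhds hp)
  have hd : DifferentiableAt ℝ (fderiv ℝ f) p :=
    (hc.fderiv_right (m := 1) (by norm_num)).differentiableAt (by norm_num)
  have hs : IsSymmSndFDerivAt ℝ f p := hc.isSymmSndFDerivAt (by simp)
  have key : ∀ v : ℝ × ℝ, HasFDerivAt (fun q => fderiv ℝ f q v)
      ((fderiv ℝ (fderiv ℝ f) p).flip v) p := by
    intro v
    have := hd.hasFDerivAt.clm_apply (hasFDerivAt_const v p)
    simpa using this
  refine ⟨(key (1, 0)).differentiableAt, (key (0, 1)).differentiableAt, ?_⟩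
  change fderiv ℝ (fun q => fderiv ℝ f q (0, 1)) p (1, 0)
    = fderiv ℝ (fun q => fderiv ℝ f q (1, 0)) p (0, 1)
  rw [(key (0, 1)).fderiv, (key (1, 0)).fderiv]
  exact hs.eq _ _

theorem aux_lin (f g : ℝ × ℝ → ℝ) (p v : ℝ × ℝ) (c d : ℝ) (hf : DifferentiableAt ℝ f p)
    (hg : DifferentiableAt ℝ g p) :
    fderiv ℝ (fun q => c * f q + d * g q) p v = c * fderiv ℝ f p v + d * fderiv ℝ g p v := by
  have := (hf.hasFDerivAt.const_mul c).add (hg.hasFDerivAt.const_mul d)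
  have h2 : fderiv ℝ (fun q => c * f q + d * g q) p = _ := this.fderiv
  rw [h2]
  simp

/-- For a `C²` displacement field whose Hooke stress satisfies the second equilibrium
equation, the derivative of the rotation is expressed through the derivative of the trace of
the stress. -/
theorem rotation_derivative_eq_trace_derivative
    (K G : ℝ) (hK : 0 < K) (hG : 0 < G)
    (U : Set (ℝ × ℝ)) (hU : IsOpen U)
    (u : ℝ × ℝ → ℝ × ℝ) (hu : ContDiffOn ℝ 2 u U)
    (hequil : ∀ p ∈ U, pd1 (hooke12 K G u) p + pd2 (hooke22 K G u) p = 0) :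
    ∀ p ∈ U, pd1 (omega21 u) p
      = -(1 / 4) * (1 / K + 1 / G) * pd2 (fun q => hooke11 K G u q + hooke22 K G u q) p := by
  intro p hp
  obtain ⟨a1, a2, ha⟩ := aux_diff U hU (fun q => (u q).1) hu.fst p hp
  obtain ⟨b1, b2, -⟩ := aux_diff U hU (fun q => (u q).2) hu.snd p hp
  have he := hequil p hp
  have e12 : hooke12 K G u = fun q => G * pd2 (fun q => (u q).1) q + G * pd1 (fun q => (u q).2) q := by
    funext q; simp only [hooke12, eps12]; ring
  have e22 : hooke22 K G u =
      fun q => (K - G) * pd1 (fun q => (u q).1) q + (K + G) * pd2 (fun q => (u q).2) q := rfl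
  have etr : (fun q => hooke11 K G u q + hooke22 K G u q) =
      fun q => (2 * K) * pd1 (fun q => (u q).1) q + (2 * K) * pd2 (fun q => (u q).2) q := by
    funext q; simp only [hooke11, hooke22, eps11, eps22]; ring
  have eom : omega21 u =
      fun q => (1 / 2) * pd1 (fun q => (u q).2) q + (-1 / 2) * pd2 (fun q => (u q).1) q := by
    funext q; simp only [omega21]; ring
  rw [e12, e22, pd1, pd2, aux_lin _ _ _ _ _ _ a2 b1, aux_lin _ _ _ _ _ _ a1 b2] at he
  rw [etr, eom, pd1, pd2, aux_lin _ _ _ _ _ _ b1 a2, aux_lin _ _ _ _ _ _ a1 b2]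
  change fderiv ℝ (pd2 fun q => (u q).1) p (1, 0) = fderiv ℝ (pd1 fun q => (u q).1) p (0, 1) at ha
  rw [ha] at he ⊢
  field_simp
  linarith
end
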